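/- arXiv:1307.8387 — 5 statements merged into one kernel-verified Lean document; each statement's English description precedes it below -/
import Mathlib

section
/- The outer automorphism group Out(F_2) of the free group of rank 2 is isomorphic to GL_2(ℤ). -/
/-- The subgroup of inner automorphisms of `G`: the range of the conjugation
homomorphism `G →* Aut G`. -/
def innerAutSubgroup (G : Type*) [Group G] : Subgroup (MulAut G) :=
  (MulAut.conj : G →* MulAut G).range

instance (G : Type*) [Group G] : (innerAutSubgroup G).Normal := by
  constructor
  rintro a ⟨g, rfl⟩ σ
  refine ⟨σ g, ?_⟩
  ext x
  simp [MulAut.conj_apply, MulAut.mul_apply, map_mul, map_inv]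

/-- The outer automorphism group of `G`: the quotient of the automorphism group of `G`
by the normal subgroup of inner automorphisms. -/
def Out (G : Type*) [Group G] : Type _ :=
  MulAut G ⧸ innerAutSubgroup G

instance (G : Type*) [Group G] : Group (Out G) :=
  QuotientGroup.Quotient.group _

namespace List

/-- The length of the longest common initial segment of two lists. -/
def commonPrefixLength {β : Type*} [DecidableEq β] : List β → List β → ℕ
  | a :: l, b :: l' => if a = b then commonPrefixLength l l' + 1 else 0
  | _, _ => 0

variable {β : Type*} [DecidableEq β]

theorem min_commonPrefixLength_le (l₁ l₂ l₃ : List β) :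
    min (commonPrefixLength l₁ l₂) (commonPrefixLength l₂ l₃) ≤ commonPrefixLength l₁ l₃ := by
  induction l₁ generalizing l₂ l₃ with
  | nil => simp [commonPrefixLength]
  | cons a l₁ ih =>
    rcases l₂ with _ | ⟨b, l₂⟩
    · simp [commonPrefixLength]
    rcases l₃ with _ | ⟨c, l₃⟩
    · simp [commonPrefixLength]
    have := ih l₂ l₃
    simp only [commonPrefixLength]
    split_ifs <;> simp_all

theorem commonPrefixLength_comm (l₁ l₂ : List β) :
    commonPrefixLength l₁ l₂ = commonPrefixLength l₂ l₁ := by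
  induction l₁ generalizing l₂ with
  | nil => cases l₂ <;> rfl
  | cons a l₁ ih =>
    cases l₂ with
    | nil => rfl
    | cons b l₂ => simp only [commonPrefixLength, ih l₂, eq_comm]

theorem commonPrefixLength_take_right (l : List β) (n : ℕ) :
    commonPrefixLength l (l.take n) = min n l.length := by
  induction l generalizing n with
  | nil => simp [commonPrefixLength]
  | cons a l ih => cases n <;> simp [commonPrefixLength, ih]

end List

namespace FreeGroup

variable {α : Type*} [DecidableEq α]

theorem IsReduced.invRev {L : List (α × Bool)} (h : IsReduced L) :
    IsReduced (FreeGroup.invRev L) := by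
  rw [isReduced_iff_reduce_eq] at h ⊢
  rw [reduce_invRev, h]

theorem norm_mk_of_isReduced {L : List (α × Bool)} (h : IsReduced L) : norm (mk L) = L.length := by
  rw [norm, toWord_mk, h.reduce_eq]

theorem norm_inv_mk_mul_mk {L₁ L₂ : List (α × Bool)} (h₁ : IsReduced L₁) (h₂ : IsReduced L₂) :
    norm ((mk L₁)⁻¹ * mk L₂) + 2 * L₁.commonPrefixLength L₂ = L₁.length + L₂.length := by
  induction L₁ generalizing L₂ with
  | nil =>
    have : mk ([] : List (α × Bool)) = 1 := rfl
    simp [List.commonPrefixLength, norm_mk_of_isReduced h₂, this]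
  | cons a L₁ ih =>
    rcases L₂ with _ | ⟨b, L₂⟩
    · have : mk ([] : List (α × Bool)) = 1 := rfl
      simpa [List.commonPrefixLength, this] using norm_mk_of_isReduced h₁.invRev
    · have h₁' : IsReduced L₁ := List.IsChain.tail h₁
      have h₂' : IsReduced L₂ := List.IsChain.tail h₂
      rw [List.commonPrefixLength]
      split_ifs with hab
      · subst hab
        have e (L : List (α × Bool)) : mk (a :: L) = mk [a] * mk L := by simp
        have := ih h₁' h₂'
        rw [e L₁, e L₂, mul_inv_rev, mul_assoc, inv_mul_cancel_left]
        simp only [List.length_cons]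
        omega
      · have : IsReduced (FreeGroup.invRev (a :: L₁) ++ b :: L₂) := by
          refine List.IsChain.append h₁.invRev h₂ ?_
          intro x hx y hy
          simp [FreeGroup.invRev] at hx hy
          subst hx hy
          intro h
          by_contra hne
          exact hab (Prod.ext h (by simpa using hne))
        rw [inv_mk, mul_mk, norm_mk_of_isReduced this]
        simp

/-- The Gromov product of two elements, based at `1`, in the Cayley tree. -/
def gromovProduct (x y : FreeGroup α) : ℕ := x.toWord.commonPrefixLength y.toWord

theorem norm_inv_mul_add (x y : FreeGroup α) :
    norm (x⁻¹ * y) + 2 * gromovProduct x y = norm x + norm y := by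
  have := norm_inv_mk_mul_mk (isReduced_toWord (x := x)) (isReduced_toWord (x := y))
  rwa [mk_toWord, mk_toWord] at this

theorem min_gromovProduct_le (x y z : FreeGroup α) :
    min (gromovProduct x y) (gromovProduct y z) ≤ gromovProduct x z :=
  List.min_commonPrefixLength_le _ _ _

theorem gromovProduct_comm (x y : FreeGroup α) : gromovProduct x y = gromovProduct y x :=
  List.commonPrefixLength_comm _ _

theorem exists_gromovProduct_eq_norm (x : FreeGroup α) {n : ℕ} (hn : n ≤ norm x) :
    ∃ p : FreeGroup α, norm p = n ∧ gromovProduct x p = n := by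
  have h : IsReduced (x.toWord.take n) :=
    List.IsChain.take isReduced_toWord n
  refine ⟨mk (x.toWord.take n), ?_, ?_⟩
  · rw [norm_mk_of_isReduced h, List.length_take]
    exact min_eq_left hn
  · rw [gromovProduct, toWord_mk, h.reduce_eq, List.commonPrefixLength_take_right]
    exact min_eq_left hn

theorem norm_lt_norm_mul_self {x : FreeGroup α} (hx : x ≠ 1) : norm x < norm (x * x) := by
  have h (n : ℕ) := congrArg List.length
    (reduceCyclically.reduce_flatten_replicate_succ (isReduced_toWord (x := x)) n)
  have h0 := h 0
  have h1 := h 1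
  have hne : reduceCyclically x.toWord ≠ [] := by
    intro h
    have := reduceCyclically.conj_conjugator_reduceCyclically x.toWord
    rw [h] at this
    apply hx
    rw [← mk_toWord (x := x), ← this, List.append_nil, ← mul_mk, ← inv_mk, mul_inv_cancel]
  have := List.length_pos_iff.2 hne
  simp [List.replicate_succ] at h0 h1
  rw [norm, norm, toWord_mul]
  omega

omit [DecidableEq α] in
theorem inv_mk_singleton (x : α × Bool) : (mk [x])⁻¹ = mk [(x.1, !x.2)] := rfl

/-- If a homomorphism cancels less than the whole of the image of each letter on its two sides,
then it does not decrease the length of words. -/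
theorem norm_le_norm_map {β : Type*} [DecidableEq β] (φ : FreeGroup α →* FreeGroup β)
    (H : ∀ x l m : α × Bool, l ≠ x → m ≠ (x.1, !x.2) →
      gromovProduct (φ (mk [l])) (φ (mk [x])) + gromovProduct (φ (mk [x]))⁻¹ (φ (mk [m])) <
        norm (φ (mk [x]))) (w : FreeGroup α) : norm w ≤ norm (φ w) := by
  have bar_ne (x : α × Bool) : (x.1, !x.2) ≠ x := fun h => by simpa using congrArg Prod.snd h
  have key (L : List (α × Bool)) : ∀ x, IsReduced (x :: L) → ∀ l, l ≠ x →
      gromovProduct (φ (mk [l])) (φ (mk (x :: L))) = gromovProduct (φ (mk [l])) (φ (mk [x])) ∧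
      gromovProduct (φ (mk [l])) (φ (mk [x])) + (L.length + 1) ≤ norm (φ (mk (x :: L))) := by
    induction L with
    | nil =>
      intro x _ l hl
      have := H x l x hl (bar_ne x).symm
      refine ⟨rfl, ?_⟩
      simp only [List.length_nil]
      omega
    | cons m L ih =>
      intro x hx l hl
      rw [isReduced_cons_cons] at hx
      have hm : m ≠ (x.1, !x.2) := by
        rintro rfl
        simpa using hx.1 rfl
      obtain ⟨h1, h2⟩ := ih m hx.2 _ hm.symm
      rw [← inv_mk_singleton, _root_.map_inv] at h1 h2
      have e : mk (x :: m :: L) = mk [x] * mk (m :: L) := by simp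
      rw [e, _root_.map_mul]
      have h3 := H x l m hl hm
      have h4 := norm_inv_mul_add (φ (mk [x]))⁻¹ (φ (mk (m :: L)))
      have h5 := norm_inv_mul_add (φ (mk [x])) (φ (mk [x]) * φ (mk (m :: L)))
      rw [inv_inv, norm_inv_eq] at h4
      rw [inv_mul_cancel_left] at h5
      have h6 := min_gromovProduct_le (φ (mk [l])) (φ (mk [x])) (φ (mk [x]) * φ (mk (m :: L)))
      have h7 := min_gromovProduct_le (φ (mk [l])) (φ (mk [x]) * φ (mk (m :: L))) (φ (mk [x]))
      rw [gromovProduct_comm (_ * _)] at h7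
      simp only [List.length_cons]
      omega
  rcases h : w.toWord with _ | ⟨x, L⟩
  · simp [norm, h]
  · have := (key L x (h ▸ isReduced_toWord) _ (bar_ne x)).2
    rw [← h, mk_toWord] at this
    rw [norm, h, List.length_cons]
    omega

/-- When `X` is cancelled by halves in `Y⁻¹ * X` and in `X * Y⁻¹`, the pair `(X, Y * X⁻¹)` has a
conjugate that is shorter than `(X, Y)`. -/
theorem exists_norm_conj_add_norm_conj_lt {X Y : FreeGroup α} (hX : X ≠ 1)
    (h₁ : 2 * gromovProduct Y X = norm X) (h₂ : 2 * gromovProduct X⁻¹ Y⁻¹ = norm X)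
    (h : norm X ≤ norm Y) :
    ∃ p : FreeGroup α, norm (p⁻¹ * X * p) + norm (p⁻¹ * (Y * X⁻¹) * p) < norm X + norm Y := by
  obtain ⟨p, hp, hXp⟩ := exists_gromovProduct_eq_norm X (n := gromovProduct Y X) (by omega)
  refine ⟨p, ?_⟩
  have hX0 : norm X ≠ 0 := by simpa [norm_eq_zero] using hX
  have a1 := norm_inv_mul_add X p
  have a2 := norm_inv_mul_add X⁻¹ (X⁻¹ * p)
  have a3 := min_gromovProduct_le Y⁻¹ X⁻¹ (X⁻¹ * p)
  have a4 := norm_inv_mul_add Y⁻¹ (X⁻¹ * p)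
  have a5 := norm_inv_mul_add Y (Y * (X⁻¹ * p))
  have a6 := min_gromovProduct_le p Y (Y * (X⁻¹ * p))
  have a7 := min_gromovProduct_le p X Y
  have a8 := norm_inv_mul_add p (Y * (X⁻¹ * p))
  have a9 := norm_mul_le (p⁻¹ * X) p
  have a10 : norm (p⁻¹ * X) = norm (X⁻¹ * p) := by rw [← norm_inv_eq]; simp
  rw [inv_inv, mul_inv_cancel_left, norm_inv_eq] at a2
  rw [inv_inv, norm_inv_eq] at a4
  rw [inv_mul_cancel_left] at a5
  rw [gromovProduct_comm Y⁻¹ X⁻¹] at a3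
  rw [gromovProduct_comm p X, gromovProduct_comm X Y] at a7
  rw [show p⁻¹ * (Y * X⁻¹) * p = p⁻¹ * (Y * (X⁻¹ * p)) by group]
  omega

/-- The automorphism of the free group of rank `2` exchanging the two generators. -/
def swapAut : MulAut (FreeGroup (Fin 2)) :=
  MonoidHom.toMulEquiv (lift ![of 1, of 0]) (lift ![of 1, of 0])
    (by ext i; fin_cases i <;> simp) (by ext i; fin_cases i <;> simp)

/-- The automorphism of the free group of rank `2` inverting the first generator. -/
def invAut : MulAut (FreeGroup (Fin 2)) :=
  MonoidHom.toMulEquiv (lift ![(of 0)⁻¹, of 1]) (lift ![(of 0)⁻¹, of 1])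
    (by ext i; fin_cases i <;> simp) (by ext i; fin_cases i <;> simp)

/-- The automorphism of the free group of rank `2` multiplying the first generator by the second
one on the right. -/
def mulAut : MulAut (FreeGroup (Fin 2)) :=
  MonoidHom.toMulEquiv (lift ![of 0 * of 1, of 1]) (lift ![of 0 * (of 1)⁻¹, of 1])
    (by ext i; fin_cases i <;> simp) (by ext i; fin_cases i <;> simp)

@[simp] theorem swapAut_of_zero : swapAut (of 0) = of 1 := by simp [swapAut]
@[simp] theorem swapAut_of_one : swapAut (of 1) = of 0 := by simp [swapAut]
@[simp] theorem swapAut_symm : MulEquiv.symm swapAut = swapAut := rfl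
@[simp] theorem invAut_of_zero : invAut (of 0) = (of 0)⁻¹ := by simp [invAut]
@[simp] theorem invAut_of_one : invAut (of 1) = of 1 := by simp [invAut]
@[simp] theorem mulAut_of_zero : mulAut (of 0) = of 0 * of 1 := by simp [mulAut]
@[simp] theorem mulAut_of_one : mulAut (of 1) = of 1 := by simp [mulAut]
@[simp] theorem mulAut_symm_of_zero : MulEquiv.symm mulAut (of 0) = of 0 * (of 1)⁻¹ := by simp [mulAut]
@[simp] theorem mulAut_symm_of_one : MulEquiv.symm mulAut (of 1) = of 1 := by simp [mulAut]

theorem mulAut_ext {φ ψ : MulAut (FreeGroup (Fin 2))} (h0 : φ (of 0) = ψ (of 0))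
    (h1 : φ (of 1) = ψ (of 1)) : φ = ψ := by
  refine MulEquiv.toMonoidHom_injective (ext_hom _ _ fun i => ?_)
  fin_cases i
  · exact h0
  · exact h1

theorem exists_mem_closure_swapAut_invAut {x y : Fin 2 × Bool} (h : x.1 ≠ y.1) :
    ∃ w ∈ Subgroup.closure {swapAut, invAut}, w (of 0) = mk [x] ∧ w (of 1) = mk [y] := by
  have hs : swapAut ∈ Subgroup.closure {swapAut, invAut} := Subgroup.subset_closure (by simp)
  have hi : invAut ∈ Subgroup.closure {swapAut, invAut} := Subgroup.subset_closure (by simp)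
  have e (i : Fin 2) : mk [(i, true)] = of i := rfl
  have e' (i : Fin 2) : mk [(i, false)] = (of i)⁻¹ := rfl
  obtain ⟨i, b⟩ := x
  obtain ⟨j, c⟩ := y
  fin_cases i <;> fin_cases j <;> (try exact absurd rfl h) <;> cases b <;> cases c
  · exact ⟨invAut * (swapAut * (invAut * swapAut)),
      mul_mem hi (mul_mem hs (mul_mem hi hs)), by simp [e'], by simp [e']⟩
  · exact ⟨invAut, hi, by simp [e'], by simp [e]⟩
  · exact ⟨swapAut * (invAut * swapAut), mul_mem hs (mul_mem hi hs), by simp [e], by simp [e']⟩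
  · exact ⟨1, one_mem _, by simp [e], by simp [e]⟩
  · exact ⟨invAut * (swapAut * invAut), mul_mem hi (mul_mem hs hi), by simp [e'], by simp [e']⟩
  · exact ⟨swapAut * invAut, mul_mem hs hi, by simp [e'], by simp [e]⟩
  · exact ⟨invAut * swapAut, mul_mem hi hs, by simp [e], by simp [e']⟩
  · exact ⟨swapAut, hs, by simp [e], by simp [e]⟩

theorem exists_eq_mk_singleton {x : FreeGroup α} (h : norm x = 1) : ∃ l, x = mk [l] := by
  obtain ⟨l, hl⟩ := List.length_eq_one_iff.1 h
  exact ⟨l, by rw [← hl, mk_toWord]⟩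

/-- An automorphism that does not decrease the length of words is a signed permutation. -/
theorem mem_closure_of_norm_le {φ : MulAut (FreeGroup (Fin 2))} (h : ∀ w, norm w ≤ norm (φ w)) :
    φ ∈ Subgroup.closure {swapAut, invAut} := by
  have hi (i : Fin 2) : ∃ l, φ⁻¹ (of i) = mk [l] := by
    refine exists_eq_mk_singleton ?_
    have h1 := h (φ⁻¹ (of i))
    rw [MulAut.apply_inv_self, norm_of] at h1
    have h2 : norm (φ⁻¹ (of i)) ≠ 0 := by
      rw [Ne, norm_eq_zero, map_eq_one_iff _ (MulEquiv.injective _)]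
      exact of_ne_one i
    omega
  obtain ⟨x, hx⟩ := hi 0
  obtain ⟨y, hy⟩ := hi 1
  have hxy : x.1 ≠ y.1 := by
    intro hxy
    have : mk [x] = mk [y] ∨ mk [x] = (mk [y])⁻¹ := by
      obtain ⟨i, b⟩ := x
      obtain ⟨j, c⟩ := y
      obtain rfl : i = j := hxy
      cases b <;> cases c <;> simp [inv_mk_singleton, -inv_mk]
    rw [← hx, ← hy, ← _root_.map_inv, (MulEquiv.injective _).eq_iff, (MulEquiv.injective _).eq_iff] at this
    revert this
    decide
  obtain ⟨w, hw, h0, h1⟩ := exists_mem_closure_swapAut_invAut hxy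
  have : φ⁻¹ = w := mulAut_ext (hx.trans h0.symm) (hy.trans h1.symm)
  rw [← inv_inv φ, this]
  exact inv_mem hw

/-- The automorphism group of the free group of rank `2` is generated by Nielsen's automorphisms
and the inner automorphisms. -/
theorem closure_sup_innerAutSubgroup :
    Subgroup.closure {swapAut, invAut, mulAut} ⊔ innerAutSubgroup (FreeGroup (Fin 2)) = ⊤ := by
  set Γ := Subgroup.closure {swapAut, invAut, mulAut} ⊔ innerAutSubgroup (FreeGroup (Fin 2))
  have hΓ : Subgroup.closure {swapAut, invAut, mulAut} ≤ Γ := le_sup_left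
  have hW : Subgroup.closure {swapAut, invAut} ≤ Γ :=
    (Subgroup.closure_mono (by grind)).trans hΓ
  have hi : invAut ∈ Γ := hΓ (Subgroup.subset_closure (by simp))
  have hm : mulAut ∈ Γ := hΓ (Subgroup.subset_closure (by simp))
  have hc (g) : MulAut.conj g ∈ Γ := le_sup_right (a := Subgroup.closure _) ⟨g, rfl⟩
  suffices ∀ n, ∀ φ : MulAut (FreeGroup (Fin 2)), norm (φ (of 0)) + norm (φ (of 1)) = n → φ ∈ Γ from
    (Subgroup.eq_top_iff' Γ).2 fun φ => this _ φ rfl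
  intro n
  induction n using Nat.strong_induction_on with
  | _ n ih =>
  intro φ hφ
  by_contra hmem
  have hmin (ψ : MulAut (FreeGroup (Fin 2))) (c) (hc' : c ∈ Γ) (ν) (hν : ν ∈ Γ)
      (hψ : ψ = c * φ * ν) : n ≤ norm (ψ (of 0)) + norm (ψ (of 1)) := by
    by_contra! hlt
    have := ih _ hlt ψ rfl
    rw [hψ, Subgroup.mul_mem_cancel_right _ hν, Subgroup.mul_mem_cancel_left _ hc'] at this
    exact hmem this
  have hnorm (l x : Fin 2 × Bool) (hlx : l.1 ≠ x.1) :
      norm (φ (mk [l])) + norm (φ (mk [x])) = n := by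
    have e (l : Fin 2 × Bool) : norm (φ (mk [l])) = norm (φ (of l.1)) := by
      obtain ⟨i, b⟩ := l
      cases b
      · rw [← Bool.not_true, ← inv_mk_singleton (i, true), _root_.map_inv, norm_inv_eq]; rfl
      · rfl
    rw [e, e]
    generalize l.1 = i at *
    generalize x.1 = j at *
    fin_cases i <;> fin_cases j <;> simp_all [add_comm]
  have hne (x : Fin 2 × Bool) : φ (mk [x]) ≠ 1 := by
    rw [Ne, map_eq_one_iff _ (MulEquiv.injective _), ← norm_eq_zero,
      norm_mk_of_isReduced IsReduced.singleton]
    simp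
  have hN1 (l x : Fin 2 × Bool) (hlx : l.1 ≠ x.1) :
      2 * gromovProduct (φ (mk [l])) (φ (mk [x])) ≤ norm (φ (mk [x])) := by
    obtain ⟨w, hw, h0, h1⟩ := exists_mem_closure_swapAut_invAut hlx
    have := hmin (φ * (w * (invAut * mulAut * invAut))) 1 (one_mem _) _
      (mul_mem (hW hw) (mul_mem (mul_mem hi hm) hi)) (by simp)
    simp [h0, h1, -inv_mk, -mul_mk] at this
    have h2 := hnorm l x hlx
    have h3 := norm_inv_mul_add (φ (mk [x])) (φ (mk [l]))
    rw [gromovProduct_comm] at h3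
    omega
  have hbar {l x : Fin 2 × Bool} (hlx : l.1 = x.1) (hne : l ≠ x) : l = (x.1, !x.2) := by
    refine Prod.ext hlx ?_
    by_contra h
    exact hne (Prod.ext hlx (by simpa using h))
  have hself (x : Fin 2 × Bool) :
      2 * gromovProduct (φ (mk [x]))⁻¹ (φ (mk [x])) < norm (φ (mk [x])) := by
    have h1 := norm_inv_mul_add (φ (mk [x]))⁻¹ (φ (mk [x]))
    have h2 := norm_lt_norm_mul_self (hne x)
    rw [inv_inv, norm_inv_eq] at h1
    omega
  refine hmem (hW (mem_closure_of_norm_le (norm_le_norm_map φ.toMonoidHom ?_)))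
  intro x l m hl hm'
  simp only [MulEquiv.toMonoidHom_eq_coe, MonoidHom.coe_coe]
  by_contra! hle
  have hinv : φ (mk [(x.1, !x.2)]) = (φ (mk [x]))⁻¹ := by rw [← inv_mk_singleton, _root_.map_inv]
  have hl1 (h : l.1 = x.1) : 2 * gromovProduct (φ (mk [l])) (φ (mk [x])) < norm (φ (mk [x])) := by
    rw [hbar h hl, hinv]
    exact hself x
  have hm1 (h : m.1 = x.1) : 2 * gromovProduct (φ (mk [x]))⁻¹ (φ (mk [m])) < norm (φ (mk [x])) := by
    obtain rfl : m = x := by simpa using hbar (x := (x.1, !x.2)) h hm'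
    exact hself m
  have hXl := hN1 l x
  have hXm := hN1 m (x.1, !x.2)
  rw [hinv, norm_inv_eq, gromovProduct_comm] at hXm
  replace hl1 : l.1 ≠ x.1 := by grind
  replace hm1 : m.1 ≠ x.1 := by grind
  replace hXl := hXl hl1
  replace hXm := hXm hm1
  have hs := hself x
  by_cases hlm : l = m
  · subst hlm
    have := min_gromovProduct_le (φ (mk [x]))⁻¹ (φ (mk [l])) (φ (mk [x]))
    omega
  have hml : m = (l.1, !l.2) := hbar (by omega) (Ne.symm hlm)
  subst hml
  rw [← inv_mk_singleton, _root_.map_inv] at hle hXm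
  have hlX := hN1 x l hl1.symm
  rw [gromovProduct_comm] at hlX
  obtain ⟨p, hp⟩ := exists_norm_conj_add_norm_conj_lt (X := φ (mk [x])) (Y := φ (mk [l])) (hne x)
    (by omega) (by omega) (by omega)
  obtain ⟨w, hw, h0, h1⟩ := exists_mem_closure_swapAut_invAut hl1
  have := hmin (MulAut.conj p⁻¹ * φ * (w * mulAut⁻¹)) _ (hc _) _
      (mul_mem (hW hw) (inv_mem hm)) rfl
  simp [h0, h1, -inv_mk, -mul_mk] at this
  have h2 := hnorm l x hl1
  simp only [mul_assoc] at hp this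
  omega

end FreeGroup

section Relations

variable {G : Type*} [Group G] {s e r : G}

/-- In a group generated by elements `s`, `e`, `r` satisfying the relations of `GL₂(ℤ)`, every
element is the product of an element of `⟨s, e⟩`, a positive word in `r` and `s * r * s`, and an
element of `⟨s, e⟩`. -/
theorem exists_mul_mem_submonoid_mul (hs : s * s = 1) (he : e * e = 1) (her : e * r * e = r⁻¹)
    (hel : e * (s * r * s) * e = (s * r * s)⁻¹) (hrl : r⁻¹ * (s * r * s) = s * e * r) {g : G}
    (hg : g ∈ Subgroup.closure {s, e, r}) :
    ∃ w₁ ∈ Subgroup.closure {s, e}, ∃ m ∈ Submonoid.closure {r, s * r * s},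
      ∃ w₂ ∈ Subgroup.closure {s, e}, g = w₁ * m * w₂ := by
  set W := Subgroup.closure {s, e}
  set l := s * r * s with hl
  set M := Submonoid.closure {r, l}
  have hsW : s ∈ W := Subgroup.subset_closure (by simp)
  have heW : e ∈ W := Subgroup.subset_closure (by simp)
  have hrM : r ∈ M := Submonoid.subset_closure (by simp)
  have hlM : l ∈ M := Submonoid.subset_closure (by simp)
  have hs' : s⁻¹ = s := inv_eq_of_mul_eq_one_left hs
  have he' : e⁻¹ = e := inv_eq_of_mul_eq_one_left he
  have hrs : r * s = s * l := by rw [hl, mul_assoc, ← mul_assoc, hs, one_mul]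
  have hlr : l⁻¹ * r = e * s * l := by
    have : l⁻¹ * r = s * (r⁻¹ * l) * s := by
      rw [hl]
      simp only [mul_inv_rev, hs', mul_assoc, hs, mul_one]
    rw [this, hrl, mul_assoc, mul_assoc, hrs, mul_assoc, ← mul_assoc s s, hs, one_mul, mul_assoc]
  let T : Set G := {r, r⁻¹, l, l⁻¹}
  have hT {w : G} (hw : w ∈ W) : ∀ t ∈ T, ∃ t' ∈ T, t * w = w * t' := by
    have hconj (w t : G) (hw : w * w = 1) (h : w * t * w ∈ T) : ∃ t' ∈ T, t * w = w * t' :=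
      ⟨_, h, by rw [mul_assoc w, ← mul_assoc w w, hw, one_mul]⟩
    have hinv (w t : G) (hw : w * w = 1) : w * t⁻¹ * w = (w * t * w)⁻¹ := by
      rw [mul_inv_rev, mul_inv_rev, inv_eq_of_mul_eq_one_left hw, mul_assoc]
    have hsls : s * l * s = r := by rw [← hrs, mul_assoc, hs, mul_one]
    have hgen : ∀ x ∈ ({s, e} : Set G), ∀ t ∈ T, ∃ t' ∈ T, t * x = x * t' := by
      rintro x hx t ht
      rcases hx with rfl | rfl
      · refine hconj _ _ hs ?_
        rcases ht with rfl | rfl | rfl | rfl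
        · simp [T, ← hl]
        · rw [hinv _ _ hs]; simp [T, ← hl]
        · simp [T, hsls]
        · rw [hinv _ _ hs]; simp [T, hsls]
      · refine hconj _ _ he ?_
        rcases ht with rfl | rfl | rfl | rfl
        · simp [T, her]
        · rw [hinv _ _ he]; simp [T, her]
        · simp [T, hel]
        · rw [hinv _ _ he]; simp [T, hel]
    induction hw using Subgroup.closure_induction'' with
    | one => exact fun t ht => ⟨t, ht, by simp⟩
    | mem x hx => exact hgen x hx
    | inv_mem x hx =>
      have hx' : x⁻¹ = x := by rcases hx with rfl | rfl <;> assumption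
      rw [hx']
      exact hgen x hx
    | mul x y _ _ ihx ihy =>
      intro t ht
      obtain ⟨t', ht', h⟩ := ihx t ht
      obtain ⟨t'', ht'', h'⟩ := ihy t' ht'
      exact ⟨t'', ht'', by rw [← mul_assoc, h, mul_assoc, h', mul_assoc]⟩
  let X : Set G := {g | ∃ w₁ ∈ W, ∃ m ∈ M, ∃ w₂ ∈ W, g = w₁ * m * w₂}
  have hWX {w g : G} (hw : w ∈ W) (hg : g ∈ X) : w * g ∈ X := by
    obtain ⟨w₁, h₁, m, hm, w₂, h₂, rfl⟩ := hg
    exact ⟨w * w₁, mul_mem hw h₁, m, hm, w₂, h₂, by simp only [mul_assoc]⟩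
  have hMW {t m w : G} (ht : t ∈ T) (hm : m ∈ M) (hw : w ∈ W) : t * (m * w) ∈ X := by
    have hMX {m : G} (hm : m ∈ M) : m * w ∈ X := ⟨1, one_mem _, m, hm, w, hw, by rw [one_mul]⟩
    rcases ht with rfl | rfl | rfl | rfl
    · rw [← mul_assoc]; exact hMX (mul_mem hrM hm)
    · induction hm using Submonoid.closure_induction_left with
      | one => exact ⟨e, heW, r, hrM, e * w, mul_mem heW hw, by
          simp only [← her, mul_assoc, one_mul]⟩
      | mul_left x hx y hy ih =>
        rcases hx with rfl | rfl
        · rw [mul_assoc, inv_mul_cancel_left]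
          exact hMX hy
        · rw [← mul_assoc, ← mul_assoc, hrl, mul_assoc _ r, mul_assoc]
          exact hWX (mul_mem hsW heW) (hMX (mul_mem hrM hy))
    · rw [← mul_assoc]; exact hMX (mul_mem hlM hm)
    · induction hm using Submonoid.closure_induction_left with
      | one => exact ⟨e, heW, l, hlM, e * w, mul_mem heW hw, by
          simp only [← hel, mul_assoc, one_mul]⟩
      | mul_left x hx y hy ih =>
        rcases hx with rfl | rfl
        · rw [← mul_assoc, ← mul_assoc, hlr, mul_assoc _ l, mul_assoc]
          exact hWX (mul_mem heW hsW) (hMX (mul_mem hlM hy))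
        · rw [mul_assoc, inv_mul_cancel_left]
          exact hMX hy
  have hTX {t g : G} (ht : t ∈ T) (hg : g ∈ X) : t * g ∈ X := by
    obtain ⟨w₁, h₁, m, hm, w₂, h₂, rfl⟩ := hg
    obtain ⟨t', ht', h⟩ := hT h₁ t ht
    rw [mul_assoc w₁, ← mul_assoc t, h, mul_assoc]
    exact hWX h₁ (hMW ht' hm h₂)
  change g ∈ X
  induction hg using Subgroup.closure_induction_left with
  | one => exact ⟨1, one_mem _, 1, one_mem _, 1, one_mem _, by simp⟩
  | mul_left x hx y _ ih =>
    rcases hx with rfl | rfl | rfl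
    · exact hWX hsW ih
    · exact hWX heW ih
    · exact hTX (by simp [T]) ih
  | inv_mul_cancel x hx y _ ih =>
    rcases hx with rfl | rfl | rfl
    · exact hWX (inv_mem hsW) ih
    · exact hWX (inv_mem heW) ih
    · exact hTX (by simp [T]) ih

/-- The elements of a dihedral group of order `8` generated by two reflections. -/
theorem mem_of_mem_closure_pair (hs : s * s = 1) (he : e * e = 1)
    (hse : s * e * s * e = e * s * e * s) {w : G} (hw : w ∈ Subgroup.closure {s, e}) :
    w ∈ ({1, s, e, s * e, e * s, s * e * s, e * s * e, s * e * s * e} : Set G) := by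
  have hs' : s⁻¹ = s := inv_eq_of_mul_eq_one_left hs
  have he' : e⁻¹ = e := inv_eq_of_mul_eq_one_left he
  have hs1 (x : G) : s * (s * x) = x := by rw [← mul_assoc, hs, one_mul]
  have he1 (x : G) : e * (e * x) = x := by rw [← mul_assoc, he, one_mul]
  have hS (y : G) (hy : y ∈ ({1, s, e, s * e, e * s, s * e * s, e * s * e, s * e * s * e} : Set G)) :
      s * y ∈ ({1, s, e, s * e, e * s, s * e * s, e * s * e, s * e * s * e} : Set G) := by
    rcases hy with rfl | rfl | rfl | rfl | rfl | rfl | rfl | rfl <;> simp [mul_assoc, hs, hs1]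
  have hE (y : G) (hy : y ∈ ({1, s, e, s * e, e * s, s * e * s, e * s * e, s * e * s * e} : Set G)) :
      e * y ∈ ({1, s, e, s * e, e * s, s * e * s, e * s * e, s * e * s * e} : Set G) := by
    simp only [mul_assoc] at hse
    rcases hy with rfl | rfl | rfl | rfl | rfl | rfl | rfl | rfl <;>
      simp [mul_assoc, he, he1, hse]
  induction hw using Subgroup.closure_induction_left with
  | one => simp
  | mul_left x hx y _ ih =>
    rcases hx with rfl | rfl
    · exact hS y ih
    · exact hE y ih
  | inv_mul_cancel x hx y _ ih =>
    rcases hx with rfl | rfl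
    · exact hs'.symm ▸ hS y ih
    · exact he'.symm ▸ hE y ih

variable {f : G →* GL (Fin 2) ℤ}

theorem eq_one_or_three_le_sum {l : G}
    (hr : (f r : Matrix (Fin 2) (Fin 2) ℤ) = !![1, 0; 1, 1])
    (hl : (f l : Matrix (Fin 2) (Fin 2) ℤ) = !![1, 1; 0, 1]) {m : G}
    (hm : m ∈ Submonoid.closure {r, l}) :
    m = 1 ∨ 3 ≤ (f m).1 0 0 + (f m).1 0 1 + (f m).1 1 0 + (f m).1 1 1 := by
  suffices (m = 1 ∨ 3 ≤ (f m).1 0 0 + (f m).1 0 1 + (f m).1 1 0 + (f m).1 1 1) ∧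
      0 ≤ (f m).1 0 0 ∧ 0 ≤ (f m).1 0 1 ∧ 0 ≤ (f m).1 1 0 ∧ 0 ≤ (f m).1 1 1 ∧
      0 < (f m).1 0 0 + (f m).1 0 1 ∧ 0 < (f m).1 1 0 + (f m).1 1 1 from this.1
  induction hm using Submonoid.closure_induction_left with
  | one => simp
  | mul_left x hx y _ ih =>
    have h2 : 2 ≤ (f y).1 0 0 + (f y).1 0 1 + (f y).1 1 0 + (f y).1 1 1 := by lia
    obtain ⟨-, ih⟩ := ih
    rcases hx with rfl | rfl
    · simp [hr, Matrix.mul_apply, Fin.sum_univ_two]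
      lia
    · simp [hl, Matrix.mul_apply, Fin.sum_univ_two]
      lia

/-- A homomorphism to `GL₂(ℤ)` from a group generated by elements satisfying the relations of the
standard generators of `GL₂(ℤ)`, sending them to these generators, is injective. -/
theorem injective_of_relations (hs : s * s = 1) (he : e * e = 1)
    (hse : s * e * s * e = e * s * e * s) (her : e * r * e = r⁻¹)
    (hel : e * (s * r * s) * e = (s * r * s)⁻¹) (hrl : r⁻¹ * (s * r * s) = s * e * r)
    (htop : Subgroup.closure {s, e, r} = ⊤)
    (hfs : (f s : Matrix (Fin 2) (Fin 2) ℤ) = !![0, 1; 1, 0])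
    (hfe : (f e : Matrix (Fin 2) (Fin 2) ℤ) = !![-1, 0; 0, 1])
    (hfr : (f r : Matrix (Fin 2) (Fin 2) ℤ) = !![1, 0; 1, 1]) :
    Function.Injective f := by
  have hW {w : G} (hw : w ∈ Subgroup.closure {s, e}) :
      (f w = 1 → w = 1) ∧ (f w).1 0 0 + (f w).1 0 1 + (f w).1 1 0 + (f w).1 1 1 ≤ 2 := by
    rw [Units.ext_iff]
    rcases mem_of_mem_closure_pair hs he hse hw with
      rfl | rfl | rfl | rfl | rfl | rfl | rfl | rfl <;>
    simp [hfs, hfe, ← Matrix.ext_iff, Fin.forall_fin_two]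
  rw [injective_iff_map_eq_one]
  intro g hg
  obtain ⟨w₁, h₁, m, hm, w₂, h₂, rfl⟩ :=
    exists_mul_mem_submonoid_mul hs he her hel hrl (g := g) (htop ▸ Subgroup.mem_top g)
  have hfm : f m = f (w₁⁻¹ * w₂⁻¹) := by
    simp only [map_mul, map_inv] at hg ⊢
    rw [eq_inv_mul_iff_mul_eq, eq_inv_iff_mul_eq_one, hg]
  obtain rfl : m = 1 := by
    refine (eq_one_or_three_le_sum hfr ?_ hm).resolve_right ?_
    · simp [hfs, hfr]
    · rw [hfm]
      exact not_le.2 ((hW (mul_mem (inv_mem h₁) (inv_mem h₂))).2.trans_lt (by norm_num))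
  rw [mul_one] at hg ⊢
  exact (hW (mul_mem h₁ h₂)).1 hg

open MatrixGroups in
theorem surjective_of_generators
    (hfs : (f s : Matrix (Fin 2) (Fin 2) ℤ) = !![0, 1; 1, 0])
    (hfe : (f e : Matrix (Fin 2) (Fin 2) ℤ) = !![-1, 0; 0, 1])
    (hfr : (f r : Matrix (Fin 2) (Fin 2) ℤ) = !![1, 0; 1, 1]) :
    Function.Surjective f := by
  have hSL (A : SL(2, ℤ)) : (A : GL (Fin 2) ℤ) ∈ f.range := by
    have hA : A ∈ Subgroup.closure {ModularGroup.S, ModularGroup.T} := by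
      rw [SpecialLinearGroup.SL2Z_generators]
      trivial
    have : Subgroup.closure {ModularGroup.S, ModularGroup.T} ≤
        f.range.comap Matrix.SpecialLinearGroup.toGL := by
      rw [Subgroup.closure_le]
      rintro A (rfl | rfl)
      · refine ⟨e * s, Units.ext ?_⟩
        simp [hfs, hfe, ModularGroup.S]
        rfl
      · refine ⟨s * r * s, Units.ext ?_⟩
        simp [hfs, hfr, ModularGroup.T]
        rfl
    exact this hA
  intro A
  rcases Int.isUnit_iff.1 ((Matrix.isUnit_iff_isUnit_det _).1 A.isUnit) with h | h
  · obtain ⟨g, hg⟩ := hSL ⟨A, h⟩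
    exact ⟨g, hg.trans (Units.ext rfl)⟩
  · obtain ⟨g, hg⟩ := hSL ⟨(f e * A : GL (Fin 2) ℤ), by
      rw [Units.val_mul, Matrix.det_mul, hfe, h]
      simp⟩
    refine ⟨e⁻¹ * g, ?_⟩
    rw [map_mul, map_inv, inv_mul_eq_iff_eq_mul]
    exact hg.trans (Units.ext rfl)

end Relations

namespace FreeGroup

/-- The abelianization of the free group of rank `2`, recording the exponent sums of the
generators. -/
def exponentSum : FreeGroup (Fin 2) →* Multiplicative (Fin 2 → ℤ) :=
  lift fun i => Multiplicative.ofAdd (Pi.single i 1)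

/-- The matrix of the endomorphism induced on the abelianization `ℤ²`. -/
def abelianizationMatrix (φ : FreeGroup (Fin 2) →* FreeGroup (Fin 2)) : Matrix (Fin 2) (Fin 2) ℤ :=
  Matrix.of fun i j => (exponentSum (φ (of j))).toAdd i

theorem toAdd_exponentSum_map (φ : FreeGroup (Fin 2) →* FreeGroup (Fin 2)) (x : FreeGroup (Fin 2)) :
    (exponentSum (φ x)).toAdd = (abelianizationMatrix φ).mulVec (exponentSum x).toAdd := by
  have : exponentSum.comp φ = (AddMonoidHom.toMultiplicative
      (abelianizationMatrix φ).mulVecLin.toAddMonoidHom).comp exponentSum := by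
    ext j
    simp [exponentSum, abelianizationMatrix]
  exact congrArg Multiplicative.toAdd (DFunLike.congr_fun this x)

/-- The action of automorphisms of the free group of rank `2` on the abelianization `ℤ²`. -/
def abelianizationAction : MulAut (FreeGroup (Fin 2)) →* GL (Fin 2) ℤ :=
  MonoidHom.toHomUnits
    { toFun := fun φ => abelianizationMatrix φ.toMonoidHom
      map_one' := by
        ext i j
        simp [abelianizationMatrix, exponentSum, Matrix.one_apply, Pi.single_apply]
      map_mul' := fun φ ψ => by
        ext i j
        exact congrFun (toAdd_exponentSum_map φ.toMonoidHom (ψ (of j))) i }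

theorem abelianizationAction_apply (φ : MulAut (FreeGroup (Fin 2))) (i j : Fin 2) :
    (abelianizationAction φ).1 i j = (exponentSum (φ (of j))).toAdd i := rfl

theorem innerAutSubgroup_le_ker_abelianizationAction :
    innerAutSubgroup (FreeGroup (Fin 2)) ≤ abelianizationAction.ker := by
  rintro _ ⟨g, rfl⟩
  rw [MonoidHom.mem_ker]
  ext i j
  rw [abelianizationAction_apply]
  simp [exponentSum, Matrix.one_apply, Pi.single_apply]

/-- The action of outer automorphisms of the free group of rank `2` on the abelianization `ℤ²`. -/
def outAction : Out (FreeGroup (Fin 2)) →* GL (Fin 2) ℤ :=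
  QuotientGroup.lift _ abelianizationAction innerAutSubgroup_le_ker_abelianizationAction

/-- The outer class of an automorphism. -/
def toOut : MulAut (FreeGroup (Fin 2)) →* Out (FreeGroup (Fin 2)) :=
  QuotientGroup.mk' _

theorem toOut_conj (g : FreeGroup (Fin 2)) : toOut (MulAut.conj g) = 1 :=
  (QuotientGroup.eq_one_iff _).2 ⟨g, rfl⟩

theorem closure_toOut :
    Subgroup.closure {toOut swapAut, toOut invAut, toOut mulAut} = ⊤ := by
  have h := congrArg (Subgroup.map toOut) closure_sup_innerAutSubgroup
  have hsurj : Function.Surjective toOut := QuotientGroup.mk'_surjective _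
  have hbot : (innerAutSubgroup (FreeGroup (Fin 2))).map toOut = ⊥ := by
    rw [eq_bot_iff]
    rintro _ ⟨_, ⟨g, rfl⟩, rfl⟩
    exact toOut_conj g
  rw [Subgroup.map_sup, hbot, sup_bot_eq, MonoidHom.map_closure,
    Subgroup.map_top_of_surjective _ hsurj] at h
  rw [← h]
  congr 1
  simp [Set.image_insert_eq]

theorem outAction_bijective : Function.Bijective outAction := by
  have hS : (outAction (toOut swapAut) : Matrix (Fin 2) (Fin 2) ℤ) = !![0, 1; 1, 0] := by
    ext i j
    change (abelianizationAction swapAut).1 i j = _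
    rw [abelianizationAction_apply]
    fin_cases i <;> fin_cases j <;> simp [exponentSum]
  have hE : (outAction (toOut invAut) : Matrix (Fin 2) (Fin 2) ℤ) = !![-1, 0; 0, 1] := by
    ext i j
    change (abelianizationAction invAut).1 i j = _
    rw [abelianizationAction_apply]
    fin_cases i <;> fin_cases j <;> simp [exponentSum]
  have hR : (outAction (toOut mulAut) : Matrix (Fin 2) (Fin 2) ℤ) = !![1, 0; 1, 1] := by
    ext i j
    change (abelianizationAction mulAut).1 i j = _
    rw [abelianizationAction_apply]
    fin_cases i <;> fin_cases j <;> simp [exponentSum]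
  refine ⟨injective_of_relations ?_ ?_ ?_ ?_ ?_ ?_ closure_toOut hS hE hR,
    surjective_of_generators hS hE hR⟩
  · rw [← _root_.map_mul, ← _root_.map_one toOut]
    exact congrArg toOut (mulAut_ext (by simp) (by simp))
  · rw [← _root_.map_mul, ← _root_.map_one toOut]
    exact congrArg toOut (mulAut_ext (by simp) (by simp))
  · simp only [← _root_.map_mul]
    exact congrArg toOut (mulAut_ext (by simp) (by simp))
  · rw [← one_mul (_ * _), ← toOut_conj (of 1)]
    simp only [← _root_.map_mul, ← _root_.map_inv]
    exact congrArg toOut (mulAut_ext (by simp) (by simp))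
  · simp only [← _root_.map_mul, ← _root_.map_inv]
    rw [eq_comm]
    exact congrArg toOut (mulAut_ext (by simp) (by simp))
  · rw [← one_mul (_⁻¹ * _), ← toOut_conj (of 1)⁻¹]
    simp only [← _root_.map_mul, ← _root_.map_inv]
    exact congrArg toOut (mulAut_ext (by simp [mul_assoc]) (by simp))

end FreeGroup

/-- The outer automorphism group of the free group of rank `2` is isomorphic to
`GL₂(ℤ)`. -/
theorem out_f2_iso_gl2z :
    Nonempty (Out (FreeGroup (Fin 2)) ≃* GL (Fin 2) ℤ) :=
  ⟨MulEquiv.ofBijective FreeGroup.outAction FreeGroup.outAction_bijective⟩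
end

section
/- For every finite simple graph Γ, the right-angled Artin group A(Γ) is torsion-free: every element of A(Γ) other than the identity has infinite order. -/
/-- The defining relators of the right-angled Artin group on the simple graph `Γ`:
one commutator relator for each edge of `Γ`. -/
def raagRels {V : Type*} (Γ : SimpleGraph V) : Set (FreeGroup V) :=
  {r : FreeGroup V | ∃ u w : V, Γ.Adj u w ∧
    r = FreeGroup.of u * FreeGroup.of w * (FreeGroup.of u)⁻¹ * (FreeGroup.of w)⁻¹}

/-- The right-angled Artin group of a simple graph `Γ`: the presented group with one
generator for each vertex of `Γ` and a commutator relator for each edge of `Γ`. -/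
abbrev RAAG {V : Type*} (Γ : SimpleGraph V) : Type _ :=
  PresentedGroup (raagRels Γ)

/-- The relators of a right-angled Artin group hold for a family of elements of a group as soon
as the elements attached to adjacent vertices commute. -/
theorem raagRels_lift_eq_one {V G : Type*} [Group G] {Γ : SimpleGraph V} {f : V → G}
    (hf : ∀ u w, Γ.Adj u w → Commute (f u) (f w)) :
    ∀ r ∈ raagRels Γ, FreeGroup.lift f r = 1 := by
  rintro _ ⟨u, w, h, rfl⟩
  simp [(hf u w h).eq]

theorem RAAG.commute_of {V : Type*} {Γ : SimpleGraph V} {u w : V} (h : Γ.Adj u w) :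
    Commute (PresentedGroup.of u : RAAG Γ) (PresentedGroup.of w) := by
  have hr := PresentedGroup.one_of_mem (rels := raagRels Γ) ⟨u, w, h, rfl⟩
  simp only [map_mul, map_inv] at hr
  exact mul_inv_eq_iff_eq_mul.mp (mul_inv_eq_one.mp hr)

/-- The homomorphism out of a right-angled Artin group determined by the images of the
generators. -/
def RAAG.lift {V G : Type*} [Group G] {Γ : SimpleGraph V} (f : V → G)
    (hf : ∀ u w, Γ.Adj u w → Commute (f u) (f w)) : RAAG Γ →* G :=
  PresentedGroup.toGroup (raagRels_lift_eq_one hf)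

@[simp]
theorem RAAG.lift_of {V G : Type*} [Group G] {Γ : SimpleGraph V} (f : V → G)
    (hf : ∀ u w, Γ.Adj u w → Commute (f u) (f w)) (v : V) :
    RAAG.lift f hf (PresentedGroup.of v) = f v :=
  PresentedGroup.toGroup.of _

/-- An extension of torsion-free groups is torsion-free; the semidirect product case. -/
theorem SemidirectProduct.eq_one_of_isOfFinOrder {N G : Type*} [Group N] [Group G]
    {φ : G →* MulAut N} (hN : ∀ x : N, IsOfFinOrder x → x = 1)
    (hG : ∀ x : G, IsOfFinOrder x → x = 1) (x : N ⋊[φ] G) (hx : IsOfFinOrder x) : x = 1 := by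
  have hr : x.right = 1 := hG _ ((SemidirectProduct.rightHom (φ := φ)).isOfFinOrder hx)
  have hl : SemidirectProduct.inl x.left = x := by
    simpa [hr] using SemidirectProduct.inl_left_mul_inr_right x
  rw [← hl, (SemidirectProduct.inl_injective (φ := φ)).isOfFinOrder_iff] at hx
  rw [← hl, hN _ hx, map_one]

/-- The action of a group on the free group on a set on which it acts. -/
def FreeGroup.permAut (G X : Type*) [Group G] [MulAction G X] : G →* MulAut (FreeGroup X) where
  toFun g := FreeGroup.freeGroupCongr (MulAction.toPerm g)
  map_one' := by
    ext x
    induction x using FreeGroup.induction_on <;> simp_all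
  map_mul' g h := by
    ext x
    induction x using FreeGroup.induction_on <;> simp_all [mul_smul]

@[simp]
theorem FreeGroup.permAut_of {G X : Type*} [Group G] [MulAction G X] (g : G) (x : X) :
    FreeGroup.permAut G X g (FreeGroup.of x) = FreeGroup.of (g • x) := by
  simp [FreeGroup.permAut]

/-- The subgroup generated by the link of the vertex `none`. -/
def RAAG.link {V : Type*} (Γ : SimpleGraph (Option V)) : Subgroup (RAAG (Γ.comap some)) :=
  Subgroup.closure (PresentedGroup.of '' {a | Γ.Adj none (some a)})

/-- The inclusion of the right-angled Artin group on the graph with the vertex `none` removed. -/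
def RAAG.inclSome {V : Type*} (Γ : SimpleGraph (Option V)) : RAAG (Γ.comap some) →* RAAG Γ :=
  RAAG.lift (fun a ↦ PresentedGroup.of (some a)) fun _ _ h ↦ RAAG.commute_of h

theorem RAAG.commute_inclSome_of_mem_link {V : Type*} {Γ : SimpleGraph (Option V)}
    {g : RAAG (Γ.comap some)} (hg : g ∈ RAAG.link Γ) :
    Commute (RAAG.inclSome Γ g) (PresentedGroup.of none) := by
  induction hg using Subgroup.closure_induction with
  | mem x hx =>
    obtain ⟨a, ha, rfl⟩ := hx
    simpa [RAAG.inclSome] using (RAAG.commute_of ha).symm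
  | one => simp
  | mul x y _ _ hx hy => simpa using hx.mul_left hy
  | inv x _ hx => simpa using hx.inv_left

/-- The conjugates of the generator `none`, indexed by the cosets of the link. -/
def RAAG.conjNone {V : Type*} (Γ : SimpleGraph (Option V)) :
    RAAG (Γ.comap some) ⧸ RAAG.link Γ → RAAG Γ :=
  Quotient.lift (fun g ↦ RAAG.inclSome Γ g * PresentedGroup.of none * (RAAG.inclSome Γ g)⁻¹) <| by
    intro a b h
    have hc := (RAAG.commute_inclSome_of_mem_link (QuotientGroup.leftRel_apply.mp h)).eq
    simp only [map_mul, map_inv] at hc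
    have hc' := congrArg (fun x ↦ RAAG.inclSome Γ a * x * (RAAG.inclSome Γ b)⁻¹) hc
    simpa [mul_assoc] using hc'.symm

theorem RAAG.conjNone_mk {V : Type*} (Γ : SimpleGraph (Option V)) (g : RAAG (Γ.comap some)) :
    RAAG.conjNone Γ (g : RAAG (Γ.comap some) ⧸ RAAG.link Γ) =
      RAAG.inclSome Γ g * PresentedGroup.of none * (RAAG.inclSome Γ g)⁻¹ :=
  rfl

/-- The semidirect product decomposition of a right-angled Artin group obtained by removing a
vertex: the kernel of the retraction is free on the cosets of the link. -/
abbrev RAAG.Split {V : Type*} (Γ : SimpleGraph (Option V)) : Type _ :=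
  FreeGroup (RAAG (Γ.comap some) ⧸ RAAG.link Γ) ⋊[FreeGroup.permAut _ _] RAAG (Γ.comap some)

/-- The image of a generator in the semidirect product decomposition. -/
def RAAG.splitGen {V : Type*} (Γ : SimpleGraph (Option V)) : Option V → RAAG.Split Γ
  | none => SemidirectProduct.inl
      (FreeGroup.of ((1 : RAAG (Γ.comap some)) : RAAG (Γ.comap some) ⧸ RAAG.link Γ))
  | some a => SemidirectProduct.inr (PresentedGroup.of a)

theorem RAAG.commute_splitGen_none {V : Type*} {Γ : SimpleGraph (Option V)} {a : V}
    (h : Γ.Adj none (some a)) :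
    Commute (RAAG.splitGen Γ none) (RAAG.splitGen Γ (some a)) := by
  have hmem : (PresentedGroup.of a : RAAG (Γ.comap some)) ∈ RAAG.link Γ :=
    Subgroup.subset_closure ⟨a, h, rfl⟩
  have hfix : (((PresentedGroup.of a : RAAG (Γ.comap some)) :
      RAAG (Γ.comap some) ⧸ RAAG.link Γ)) = ((1 : RAAG (Γ.comap some)) : _) := by
    rw [eq_comm, QuotientGroup.eq]
    simpa using hmem
  have hsmul : (PresentedGroup.of a : RAAG (Γ.comap some)) •
      ((1 : RAAG (Γ.comap some)) : RAAG (Γ.comap some) ⧸ RAAG.link Γ) =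
        ((1 : RAAG (Γ.comap some)) : _) := by
    rw [MulAction.Quotient.smul_coe, smul_eq_mul, mul_one, hfix]
  refine SemidirectProduct.ext ?_ ?_ <;> simp [RAAG.splitGen, hsmul]

/-- The map from a right-angled Artin group to its semidirect product decomposition. -/
def RAAG.toSplit {V : Type*} (Γ : SimpleGraph (Option V)) : RAAG Γ →* RAAG.Split Γ :=
  RAAG.lift (RAAG.splitGen Γ) <| by
    rintro (_ | a) (_ | b) h
    · exact Commute.refl _
    · exact RAAG.commute_splitGen_none h
    · exact (RAAG.commute_splitGen_none h.symm).symm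
    · exact (RAAG.commute_of (Γ := Γ.comap some) h).map SemidirectProduct.inr

/-- The map from the semidirect product decomposition back to the right-angled Artin group. -/
def RAAG.ofSplit {V : Type*} (Γ : SimpleGraph (Option V)) : RAAG.Split Γ →* RAAG Γ :=
  SemidirectProduct.lift (FreeGroup.lift (RAAG.conjNone Γ)) (RAAG.inclSome Γ) <| by
    intro g
    ext x
    induction x using QuotientGroup.induction_on with
    | H x =>
      simp [RAAG.conjNone_mk, MulAction.Quotient.smul_mk, mul_assoc]

theorem RAAG.toSplit_injective {V : Type*} (Γ : SimpleGraph (Option V)) :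
    Function.Injective (RAAG.toSplit Γ) := by
  have h : (RAAG.ofSplit Γ).comp (RAAG.toSplit Γ) = MonoidHom.id _ := by
    apply PresentedGroup.ext
    rintro (_ | a)
    · simp [RAAG.toSplit, RAAG.ofSplit, RAAG.splitGen, RAAG.conjNone_mk]
    · simp [RAAG.toSplit, RAAG.ofSplit, RAAG.splitGen, RAAG.inclSome]
  exact Function.LeftInverse.injective (g := RAAG.ofSplit Γ) (DFunLike.congr_fun h)

theorem RAAG.exists_injective_comap_equiv {V W : Type*} (e : V ≃ W) (Γ : SimpleGraph W) :
    ∃ f : RAAG Γ →* RAAG (Γ.comap e), Function.Injective f := by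
  let f : RAAG Γ →* RAAG (Γ.comap e) :=
    RAAG.lift (fun w ↦ PresentedGroup.of (e.symm w)) fun u w h ↦
      RAAG.commute_of (by simpa using h)
  let k : RAAG (Γ.comap e) →* RAAG Γ :=
    RAAG.lift (fun v ↦ PresentedGroup.of (e v)) fun _ _ h ↦ RAAG.commute_of h
  have h : k.comp f = MonoidHom.id _ := by
    apply PresentedGroup.ext
    simp [f, k]
  exact ⟨f, Function.LeftInverse.injective (g := k) (DFunLike.congr_fun h)⟩

theorem RAAG.eq_one_of_isOfFinOrder (V : Type) [Finite V] :
    ∀ (Γ : SimpleGraph V) (g : RAAG Γ), IsOfFinOrder g → g = 1 := by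
  induction V using Finite.induction_empty_option with
  | of_equiv e ih =>
    intro Γ g hg
    obtain ⟨f, hf⟩ := RAAG.exists_injective_comap_equiv e Γ
    exact (map_eq_one_iff f hf).mp (ih _ _ (f.isOfFinOrder hg))
  | h_empty =>
    intro Γ g _
    have h : MonoidHom.id (RAAG Γ) = 1 := PresentedGroup.ext fun x ↦ x.elim
    exact DFunLike.congr_fun h g
  | h_option ih =>
    intro Γ g hg
    refine (map_eq_one_iff _ (RAAG.toSplit_injective Γ)).mp ?_
    refine SemidirectProduct.eq_one_of_isOfFinOrder (fun x hx ↦ ?_) (ih _) _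
      ((RAAG.toSplit Γ).isOfFinOrder hg)
    by_contra hne
    exact not_isOfFinOrder_of_isMulTorsionFree hne hx

/-- Right-angled Artin groups are torsion-free: every nontrivial element has infinite
order. -/
theorem raag_torsion_free {V : Type} [Fintype V] (Γ : SimpleGraph V)
    (g : RAAG Γ) (hg : g ≠ 1) : ¬ IsOfFinOrder g :=
  fun h ↦ hg (RAAG.eq_one_of_isOfFinOrder V Γ g h)
end

section
/- For every n ≥ 1 there exists a constant C (depending only on n) such that every finite subgroup of the outer automorphism group Out(F_n) of the free group F_n has cardinality at most C. -/
section PolynomialMaps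

variable {F : Type*} [Group F]

/-- Polynomial maps of degree less than `k` from a group to `ℤ`: those annihilated by any `k`
successive (left or right) difference operators. -/
def IsPolyMap : ℕ → (F → ℤ) → Prop
  | 0, f => ∀ x, f x = 0
  | k + 1, f => ∀ h, IsPolyMap k (fun x => f (x * h) - f x) ∧
      IsPolyMap k (fun x => f (h * x) - f x)

/-- A finite order automorphism fixing all homomorphisms to `ℤ` fixes all polynomial maps. -/
theorem IsPolyMap.apply_eq_of_pow_eq_one {s : MulAut F} {m : ℕ} (hm : m ≠ 0) (hs : s ^ m = 1)
    (hab : ∀ e : F → ℤ, (∀ x y, e (x * y) = e x + e y) → ∀ x, e (s x) = e x) :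
    ∀ {k : ℕ} {f : F → ℤ}, IsPolyMap k f → ∀ x, f (s x) = f x
  | 0, f, hf, x => by rw [hf, hf]
  | k + 1, f, hf, x => by
    have hr : ∀ x h, f (s x * s h) - f (s x) = f (x * s h) - f x := fun x h =>
      apply_eq_of_pow_eq_one hm hs hab (hf (s h)).1 x
    have hl : ∀ x h, f (x * s h) - f (s h) = f (x * h) - f h := fun x h =>
      apply_eq_of_pow_eq_one hm hs hab (hf x).2 h
    have hadd : ∀ x y, (fun x => f (s x) - f x) (x * y) =
        (fun x => f (s x) - f x) x + (fun x => f (s x) - f x) y := by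
      intro x y
      have h1 := hr x y
      have h2 := hl x y
      simp only [map_mul]
      linarith
    have he := hab (fun x => f (s x) - f x) hadd
    have hpow : ∀ j : ℕ, f ((s ^ j) x) = f x + j * (f (s x) - f x) := by
      have hconst : ∀ j : ℕ, f (s ((s ^ j) x)) - f ((s ^ j) x) = f (s x) - f x := by
        intro j
        induction j with
        | zero => simp
        | succ j ih => rw [pow_succ', MulAut.mul_apply, ← ih]; exact he _
      intro j
      induction j with
      | zero => simp
      | succ j ih =>
        have := hconst j
        rw [pow_succ', MulAut.mul_apply]
        push_cast
        linarith
    have h := hpow m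
    rw [hs, MulAut.one_apply] at h
    have : (m : ℤ) * (f (s x) - f x) = 0 := by linarith
    rcases mul_eq_zero.1 this with h | h
    · exact absurd (by exact_mod_cast h) hm
    · linarith

theorem eq_zero_of_eq_mul_succ {d : ℕ → ℤ} {Q : ℕ} (hQ : 2 ≤ Q)
    (hd : ∀ i, d i = Q * d (i + 1)) (i : ℕ) : d i = 0 := by
  have key : ∀ N i, (d i).natAbs ≤ N → d i = 0 := by
    intro N
    induction N with
    | zero => intro i hi; omega
    | succ N ih =>
      intro i hi
      have h1 : (d i).natAbs = Q * (d (i + 1)).natAbs := by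
        rw [hd i, Int.natAbs_mul, Int.natAbs_natCast]
      have h2 : d (i + 1) = 0 := by
        apply ih
        nlinarith
      rw [hd i, h2, mul_zero]
  exact key _ i le_rfl

/-- Polynomial maps do not see infinitely divisible elements. -/
theorem IsPolyMap.apply_mul_mul_eq {γ : ℕ → F} {Q : ℕ} (hQ : 2 ≤ Q)
    (hγ : ∀ i, γ i = γ (i + 1) ^ Q) :
    ∀ {k : ℕ} {f : F → ℤ}, IsPolyMap k f → ∀ i x y, f (x * γ i * y) = f (x * y)
  | 0, f, hf, i, x, y => by rw [hf, hf]
  | k + 1, f, hf, i, x, y => by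
    have hr : ∀ i x y, f (x * γ i * y) - f (x * y) = f (x * γ i) - f x := by
      intro i x y
      have := apply_mul_mul_eq hQ hγ (hf y).1 i x 1
      simp only [mul_one] at this
      linarith
    have hl : ∀ i x, f (x * γ i) - f x = f (γ i) - f 1 := by
      intro i x
      have := apply_mul_mul_eq hQ hγ (hf x).2 i 1 1
      simp only [mul_one, one_mul] at this
      linarith
    have hpow : ∀ i (j : ℕ), f (γ i ^ j) = f 1 + j * (f (γ i) - f 1) := by
      intro i j
      induction j with
      | zero => simp
      | succ j ih =>
        have := hl i (γ i ^ j)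
        rw [pow_succ]
        push_cast
        linarith
    have h0 := eq_zero_of_eq_mul_succ (d := fun i => f (γ i) - f 1) hQ (fun i => by
      have := hpow (i + 1) Q
      rw [← hγ] at this
      linarith) i
    have := hr i x y
    have := hl i x
    linarith

end PolynomialMaps

section MagnusRepresentation

variable {ι : Type*}

/-- Functions on words vanishing on words of length less than `j`. -/
def VanishesBelow (j : ℕ) (v : List ι → ℤ) : Prop := ∀ l, l.length < j → v l = 0

theorem VanishesBelow.mono {j k : ℕ} (h : j ≤ k) {v : List ι → ℤ} (hv : VanishesBelow k v) :
    VanishesBelow j v := fun l hl => hv l (hl.trans_le h)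

theorem VanishesBelow.add {j : ℕ} {v w : List ι → ℤ} (hv : VanishesBelow j v)
    (hw : VanishesBelow j w) : VanishesBelow j (v + w) := fun l hl => by
  simp [hv l hl, hw l hl]

/-- The element of the free group spelled by a list of syllables `xᵢ ^ e`. -/
def syllableProd (l : List (ι × ℤ)) : FreeGroup ι :=
  (l.map fun p => FreeGroup.of p.1 ^ p.2).prod

theorem syllableProd_cons (p : ι × ℤ) (l : List (ι × ℤ)) :
    syllableProd (p :: l) = FreeGroup.of p.1 ^ p.2 * syllableProd l := by
  simp [syllableProd]

variable [DecidableEq ι]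

/-- The operator on functions on words that strips a leading letter `i` (not followed by another
`i`). -/
def stripLetter (i : ι) : Module.End ℤ (List ι → ℤ) where
  toFun f
    | [] => 0
    | j :: l => if i = j ∧ l.head? ≠ some i then f l else 0
  map_add' f g := by
    ext (_ | ⟨j, l⟩)
    · simp
    · simp only [Pi.add_apply]; split_ifs <;> simp
  map_smul' c f := by
    ext (_ | ⟨j, l⟩)
    · simp
    · simp

@[simp] theorem stripLetter_nil (i : ι) (f : List ι → ℤ) : stripLetter i f [] = 0 := rfl

theorem stripLetter_cons (i j : ι) (l : List ι) (f : List ι → ℤ) :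
    stripLetter i f (j :: l) = if i = j ∧ l.head? ≠ some i then f l else 0 := rfl

theorem stripLetter_mul_self (i : ι) : stripLetter i * stripLetter i = 0 := by
  ext f (_ | ⟨j, _ | ⟨k, l⟩⟩)
  · simp
  · simp [stripLetter_cons]
  · simp only [Module.End.mul_apply, stripLetter_cons, LinearMap.zero_apply, Pi.zero_apply]
    split_ifs with h1 h2
    · simp [h2.1] at h1
    · rfl
    · rfl

/-- The unipotent operator `1 + stripLetter i`. -/
def stripUnit (i : ι) : (Module.End ℤ (List ι → ℤ))ˣ where
  val := 1 + stripLetter i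
  inv := 1 - stripLetter i
  val_inv := by
    have := stripLetter_mul_self i
    simp [mul_sub, add_mul, this]
  inv_val := by
    have := stripLetter_mul_self i
    simp [mul_add, sub_mul, this]

/-- A truncated Magnus representation of the free group. -/
def magnusRep : FreeGroup ι →* (Module.End ℤ (List ι → ℤ))ˣ := FreeGroup.lift stripUnit

theorem magnusRep_of_zpow (i : ι) (e : ℤ) :
    ((magnusRep (FreeGroup.of i ^ e) : (Module.End ℤ (List ι → ℤ))ˣ) :
      Module.End ℤ (List ι → ℤ)) = 1 + e • stripLetter i := by
  have h := stripLetter_mul_self i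
  induction e with
  | zero => simp
  | succ n ih =>
    rw [zpow_add_one, map_mul, Units.val_mul, ih]
    simp [magnusRep, stripUnit, mul_add, add_mul, h, add_smul, mul_assoc]
    abel
  | pred n ih =>
    rw [zpow_sub_one, map_mul, map_inv, Units.val_mul, ih]
    simp only [magnusRep, FreeGroup.lift_apply_of]
    change _ * (1 - stripLetter i) = _
    simp [mul_sub, add_mul, sub_smul, h, mul_assoc]
    abel

theorem VanishesBelow.stripLetter {j : ℕ} {v : List ι → ℤ} (hv : VanishesBelow j v) (i : ι) :
    VanishesBelow (j + 1) (stripLetter i v) := by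
  rintro (_ | ⟨k, l⟩) hl
  · rfl
  · rw [stripLetter_cons]
    split_ifs
    · exact hv _ (by simpa using hl)
    · rfl

theorem VanishesBelow.magnusRep_sub (x : FreeGroup ι) :
    ∀ {j : ℕ} {v : List ι → ℤ}, VanishesBelow j v →
      VanishesBelow (j + 1) ((magnusRep x : Module.End ℤ (List ι → ℤ)) v - v) := by
  induction x using FreeGroup.induction_on with
  | C1 => intro j v _ l _; simp
  | of i =>
    intro j v hv
    have := magnusRep_of_zpow i 1
    simp only [zpow_one, one_smul] at this
    rw [this]
    simpa using hv.stripLetter i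
  | inv_of i _ =>
    intro j v hv l hl
    have := magnusRep_of_zpow i (-1)
    simp only [zpow_neg_one, neg_smul, one_smul] at this
    rw [this]
    simpa using hv.stripLetter i l hl
  | mul x y hx hy =>
    intro j v hv
    have h1 := hy hv
    have h2 := hx ((h1.mono (Nat.le_succ j)).add hv)
    rw [sub_add_cancel] at h2
    have := h2.add h1
    rwa [sub_add_sub_cancel, ← Module.End.mul_apply, ← Units.val_mul, ← map_mul] at this

theorem VanishesBelow.magnusRep (x : FreeGroup ι) {j : ℕ} {v : List ι → ℤ}
    (hv : VanishesBelow j v) :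
    VanishesBelow j ((magnusRep x : Module.End ℤ (List ι → ℤ)) v) := by
  have := ((hv.magnusRep_sub x).mono (Nat.le_succ j)).add hv
  rwa [sub_add_cancel] at this

theorem isPolyMap_magnusRep (k : ℕ) : ∀ {j : ℕ} {v : List ι → ℤ} (c : (List ι → ℤ) →ₗ[ℤ] ℤ),
    VanishesBelow j v → (∀ u, VanishesBelow (j + k) u → c u = 0) →
      IsPolyMap k (fun x : FreeGroup ι => c ((magnusRep x : Module.End ℤ (List ι → ℤ)) v)) := by
  induction k with
  | zero => exact fun c hv hc x => hc _ (hv.magnusRep x)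
  | succ k ih =>
    intro j v c hv hc h
    constructor
    · convert ih c (hv.magnusRep_sub h) (fun u hu => hc u (by rwa [← add_assoc, add_right_comm]))
        using 2
      simp
    · convert ih (c ∘ₗ ((_root_.magnusRep h : Module.End ℤ (List ι → ℤ)) - 1)) hv
        (fun u hu => hc _ (hu.magnusRep_sub h)) using 2
      simp

/-- The Magnus coefficient of `x` at a word. -/
def magnusCoeff (x : FreeGroup ι) (L : List ι) : ℤ :=
  (magnusRep x : Module.End ℤ (List ι → ℤ)) (Pi.single [] 1) L

theorem magnusCoeff_one (L : List ι) : magnusCoeff 1 L = (Pi.single [] 1 : List ι → ℤ) L := by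
  simp [magnusCoeff]

theorem magnusCoeff_syllableProd_cons (i j : ι) (e : ℤ) (l : List (ι × ℤ)) (L : List ι) :
    magnusCoeff (syllableProd ((i, e) :: l)) (j :: L) = magnusCoeff (syllableProd l) (j :: L) +
      e * if i = j ∧ L.head? ≠ some i then magnusCoeff (syllableProd l) L else 0 := by
  rw [syllableProd_cons, magnusCoeff, map_mul, Units.val_mul, magnusRep_of_zpow]
  simp [magnusCoeff, stripLetter_cons]

theorem magnusCoeff_eq_zero_of_length_lt {l : List (ι × ℤ)} :
    ∀ {L : List ι}, l.length < L.length → magnusCoeff (syllableProd l) L = 0 := by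
  induction l with
  | nil =>
    rintro (_ | ⟨j, L⟩) h
    · simp at h
    · simp [syllableProd, magnusCoeff_one]
  | cons p l ih =>
    rintro (_ | ⟨j, L⟩) h
    · simp at h
    · simp only [List.length_cons, Nat.add_lt_add_iff_right] at h
      rw [magnusCoeff_syllableProd_cons, ih (by simp; omega), ih h]
      simp

theorem magnusCoeff_eq_zero_of_ne {p : ι × ℤ} {l : List (ι × ℤ)} {j : ι} {L : List ι}
    (h : l.length = L.length) (hj : p.1 ≠ j) :
    magnusCoeff (syllableProd (p :: l)) (j :: L) = 0 := by
  rw [magnusCoeff_syllableProd_cons, magnusCoeff_eq_zero_of_length_lt (by simp [h])]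
  simp [hj]

/-- Syllable lists in normal form. -/
def IsReducedSyllables (l : List (ι × ℤ)) : Prop :=
  (∀ p ∈ l, p.2 ≠ 0) ∧ l.IsChain fun p q => p.1 ≠ q.1

theorem IsReducedSyllables.magnusCoeff_ne_zero {l : List (ι × ℤ)} (h : IsReducedSyllables l) :
    magnusCoeff (syllableProd l) (l.map Prod.fst) ≠ 0 := by
  induction l with
  | nil => simp [syllableProd, magnusCoeff_one]
  | cons p l ih =>
    have hl : IsReducedSyllables l := ⟨fun q hq => h.1 q (List.mem_cons_of_mem _ hq), h.2.tail⟩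
    rw [List.map_cons, magnusCoeff_syllableProd_cons,
      magnusCoeff_eq_zero_of_length_lt (by simp), if_pos, zero_add]
    · exact mul_ne_zero (h.1 p List.mem_cons_self) (ih hl)
    · refine ⟨rfl, ?_⟩
      rcases l with _ | ⟨q, l⟩
      · simp
      · have := h.2
        simp only [List.isChain_cons_cons] at this
        simpa using this.1.symm

theorem IsReducedSyllables.exists_zpow_mul {l : List (ι × ℤ)} (h : IsReducedSyllables l) (i : ι)
    (e : ℤ) : ∃ l', IsReducedSyllables l' ∧
      FreeGroup.of i ^ e * syllableProd l = syllableProd l' := by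
  by_cases he : e = 0
  · exact ⟨l, h, by simp [he]⟩
  rcases l with _ | ⟨⟨j, d⟩, l⟩
  · exact ⟨[(i, e)], ⟨by simpa, by simp⟩, by simp [syllableProd]⟩
  by_cases hij : i = j
  · subst hij
    have hl : IsReducedSyllables l := ⟨fun q hq => h.1 q (List.mem_cons_of_mem _ hq), h.2.tail⟩
    by_cases hd : e + d = 0
    · exact ⟨l, hl, by rw [syllableProd_cons, ← mul_assoc, ← zpow_add, hd]; simp⟩
    · refine ⟨(i, e + d) :: l, ⟨?_, ?_⟩, ?_⟩
      · intro q hq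
        rcases List.mem_cons.1 hq with rfl | hq
        · exact hd
        · exact hl.1 q hq
      · have := h.2
        rw [List.isChain_cons] at this ⊢
        exact this
      · rw [syllableProd_cons, syllableProd_cons, ← mul_assoc, ← zpow_add]
  · refine ⟨(i, e) :: (j, d) :: l, ⟨?_, ?_⟩, ?_⟩
    · intro q hq
      rcases List.mem_cons.1 hq with rfl | hq
      · exact he
      · exact h.1 q hq
    · exact List.isChain_cons_cons.2 ⟨hij, h.2⟩
    · rw [syllableProd_cons (i, e)]

theorem exists_syllableProd_eq (x : FreeGroup ι) :
    ∃ l, IsReducedSyllables l ∧ x = syllableProd l := by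
  suffices H : ∀ l, IsReducedSyllables l →
      ∃ l', IsReducedSyllables l' ∧ x * syllableProd l = syllableProd l' by
    obtain ⟨l, hl, h⟩ := H [] ⟨by simp, by simp⟩
    exact ⟨l, hl, by simpa [syllableProd] using h⟩
  induction x using FreeGroup.induction_on with
  | C1 => exact fun l hl => ⟨l, hl, one_mul _⟩
  | of i => exact fun l hl => by simpa using hl.exists_zpow_mul i 1
  | inv_of i _ => exact fun l hl => by simpa using hl.exists_zpow_mul i (-1)
  | mul x y hx hy =>
    intro l hl
    obtain ⟨l', hl', h'⟩ := hy l hl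
    obtain ⟨l'', hl'', h''⟩ := hx l' hl'
    exact ⟨l'', hl'', by rw [mul_assoc, h', h'']⟩

theorem isPolyMap_magnusCoeff (L : List ι) :
    IsPolyMap (L.length + 1) (fun x => magnusCoeff x L) :=
  isPolyMap_magnusRep (j := 0) _ (LinearMap.proj L) (fun _ hl => absurd hl (by simp))
    (fun u hu => hu L (by simp))

/-- Polynomial maps separate the points of a free group. -/
theorem eq_of_forall_isPolyMap {x y : FreeGroup ι}
    (h : ∀ k (f : FreeGroup ι → ℤ), IsPolyMap k f → f x = f y) : x = y := by
  have hxy : (magnusRep x : Module.End ℤ (List ι → ℤ)) (Pi.single [] 1) =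
      (magnusRep y : Module.End ℤ (List ι → ℤ)) (Pi.single [] 1) :=
    funext fun L => h _ _ (isPolyMap_magnusCoeff L)
  have h1 : ∀ L, magnusCoeff (x⁻¹ * y) L = (Pi.single [] 1 : List ι → ℤ) L := fun L => by
    rw [magnusCoeff, map_mul, Units.val_mul, Module.End.mul_apply, ← hxy, ← Module.End.mul_apply,
      ← Units.val_mul, ← map_mul, inv_mul_cancel]
    simp
  obtain ⟨l, hl, hw⟩ := exists_syllableProd_eq (x⁻¹ * y)
  have hne := hl.magnusCoeff_ne_zero
  rw [← hw, h1] at hne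
  rcases l with _ | ⟨p, l⟩
  · exact inv_mul_eq_one.1 hw
  · simp at hne

/-- An element commuting with all generators of a free group of rank at least two is trivial. -/
theorem FreeGroup.eq_one_of_forall_commute [Nontrivial ι] {x : FreeGroup ι}
    (h : ∀ y, y * x = x * y) : x = 1 := by
  obtain ⟨l, hl, rfl⟩ := exists_syllableProd_eq x
  rcases l with _ | ⟨⟨i, e⟩, l⟩
  · rfl
  obtain ⟨j, hj⟩ := exists_ne i
  have hred : IsReducedSyllables ((j, 1) :: (i, e) :: l) := by
    refine ⟨fun q hq => ?_, List.isChain_cons_cons.2 ⟨hj, hl.2⟩⟩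
    rcases List.mem_cons.1 hq with rfl | hq
    · exact one_ne_zero
    · exact hl.1 q hq
  refine absurd ?_ hred.magnusCoeff_ne_zero
  have hxj : syllableProd ((j, 1) :: (i, e) :: l) = syllableProd ((i, e) :: (l ++ [(j, 1)])) := by
    rw [syllableProd_cons, h]
    simp [syllableProd, mul_assoc]
  rw [hxj]
  exact magnusCoeff_eq_zero_of_ne (by simp) hj.symm

end MagnusRepresentation

section CyclicWords

theorem sum_pow_eq_sum_ofFn_prod {S R : Type*} [Fintype S] [Semiring R] (a : S → R) (m : ℕ) :
    (∑ s, a s) ^ m = ∑ f : Fin m → S, (List.ofFn fun i => a (f i)).prod := by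
  induction m with
  | zero => simp
  | succ m ih =>
    rw [pow_succ', ih, Finset.sum_mul_sum, ← Finset.sum_product',
      ← (Fin.consEquiv fun _ => S).sum_comp]
    simp [Fin.consEquiv, List.ofFn_succ]

/-- A function with values in a group of exponent `p`, invariant under a permutation of order
dividing `p`, has the same sum as its restriction to the fixed points. -/
theorem sum_eq_sum_fixedPoints {X V : Type*} [Fintype X] [DecidableEq X] [AddCommGroup V] {p : ℕ}
    [Fact p.Prime] (hV : ∀ v : V, p • v = 0) (σ : X → X) (hσ : ∀ x, σ^[p] x = x) (w : X → V)
    (hw : ∀ x, w (σ x) = w x) : ∑ x, w x = ∑ x with σ x = x, w x := by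
  classical
  rw [← Finset.sum_fiberwise_of_maps_to (s := Finset.univ) (g := w)
    (fun x _ => Finset.mem_image_of_mem w (Finset.mem_univ x)),
    ← Finset.sum_fiberwise_of_maps_to (s := Finset.univ.filter fun x => σ x = x) (g := w)
    (t := Finset.univ.image w)
    (fun x _ => Finset.mem_image_of_mem w (Finset.mem_univ x))]
  refine Finset.sum_congr rfl fun v _ => ?_
  rw [Finset.sum_congr rfl (g := fun _ => v) (by simp),
    Finset.sum_congr (s₁ := Finset.filter _ (Finset.filter _ _)) rfl (g := fun _ => v) (by simp),
    Finset.sum_const, Finset.sum_const]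
  let g : Function.End {x // w x = v} := fun x => ⟨σ x, (hw x).trans x.2⟩
  have hg : g ^ p ^ 1 = 1 := by
    rw [pow_one]
    refine funext fun x => Subtype.ext ?_
    have : ∀ k : ℕ, ((g ^ k) x : X) = σ^[k] x := by
      intro k
      induction k with
      | zero => rfl
      | succ k ih => rw [pow_succ', Function.iterate_succ_apply', ← ih]; rfl
    exact (this p).trans (hσ x)
  have h := Equiv.Perm.card_fixedPoints_modEq hg
  rw [Fintype.card_subtype] at h
  have h2 : Fintype.card (Function.fixedPoints g) =
      (Finset.filter (fun x => w x = v) (Finset.filter (fun x => σ x = x) Finset.univ)).card := by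
    rw [Finset.filter_filter, ← Fintype.card_subtype]
    refine Fintype.card_congr ⟨fun x => ⟨x.1.1, congrArg Subtype.val x.2, x.1.2⟩,
      fun x => ⟨⟨x.1, x.2.2⟩, Subtype.ext x.2.1⟩, fun _ => rfl, fun _ => rfl⟩
  rw [h2] at h
  obtain ⟨c, hc⟩ := (Nat.modEq_iff_dvd.1 h)
  rw [← natCast_zsmul, ← natCast_zsmul, eq_comm, ← sub_eq_zero, ← sub_smul, hc, mul_comm,
    mul_smul, natCast_zsmul, hV, smul_zero]

/-- Modulo `p` and commutators, the `p`-th power map is additive. -/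
theorem trace_add_pow_prime {R V : Type*} [Ring R] [AddCommGroup V] {p : ℕ} [hp : Fact p.Prime]
    (hV : ∀ v : V, p • v = 0) (τ : R →+ V) (hτ : ∀ a b, τ (a * b) = τ (b * a)) (a b : R) :
    τ ((a + b) ^ p) = τ (a ^ p) + τ (b ^ p) := by
  obtain ⟨m, rfl⟩ : ∃ m, p = m + 1 := ⟨p - 1, (Nat.succ_pred hp.out.ne_zero).symm⟩
  let c : Bool → R := fun s => if s then a else b
  have hab : a + b = ∑ s, c s := by simp [c]
  let w : (Fin (m + 1) → Bool) → V := fun f => τ (List.ofFn fun i => c (f i)).prod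
  let σ : (Fin (m + 1) → Bool) → (Fin (m + 1) → Bool) := fun f i => f (i + 1)
  have hσ : ∀ f, σ^[m + 1] f = f := by
    have : ∀ (k : ℕ) f i, σ^[k] f i = f (i + k • 1) := by
      intro k
      induction k with
      | zero => simp
      | succ k ih =>
        intro f i
        rw [Function.iterate_succ_apply, ih]
        simp only [σ, succ_nsmul, add_assoc]
    intro f
    ext i
    rw [this, show (m + 1) • (1 : Fin (m + 1)) = 0 by
      simpa using card_nsmul_eq_zero (x := (1 : Fin (m + 1))), add_zero]
  have hw : ∀ f, w (σ f) = w f := by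
    intro f
    simp only [w, σ]
    rw [List.ofFn_succ', List.ofFn_succ, List.concat_eq_append, List.prod_append, hτ]
    simp
  have hfix : (Finset.univ.filter fun f => σ f = f) = {fun _ => true, fun _ => false} := by
    ext f
    simp only [Finset.mem_filter, Finset.mem_univ, true_and, Finset.mem_insert,
      Finset.mem_singleton]
    constructor
    · intro h
      have hconst : ∀ i, f i = f 0 := by
        intro i
        induction i using Fin.induction with
        | zero => rfl
        | succ i ih => rw [← ih, ← congrFun h i.castSucc]; simp [σ]
      cases h0 : f 0
      · exact Or.inr (funext fun i => (hconst i).trans h0)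
      · exact Or.inl (funext fun i => (hconst i).trans h0)
    · rintro (rfl | rfl) <;> rfl
  rw [hab, sum_pow_eq_sum_ofFn_prod, map_sum]
  refine (sum_eq_sum_fixedPoints hV σ hσ w hw).trans ?_
  rw [hfix, Finset.sum_pair (fun h => by simpa using congrFun h 0)]
  simp [w, c, pow_succ']

end CyclicWords

section ConjugacyTrace

variable {A : Type*} [Group A]

/-- The map from a group ring to functions on conjugacy classes. -/
noncomputable def classSum (A k : Type*) [Group A] [CommRing k] :
    MonoidAlgebra ℤ A →+ (ConjClasses A →₀ k) :=
  (Finsupp.liftAddHom fun g => (Finsupp.singleAddHom (ConjClasses.mk g)).comp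
    (Int.castAddHom k)).comp MonoidAlgebra.coeffAddEquiv.toAddMonoidHom

@[simp] theorem classSum_single (k : Type*) [CommRing k] (g : A) (c : ℤ) :
    classSum A k (MonoidAlgebra.single g c) = Finsupp.single (ConjClasses.mk g) (c : k) := by
  simp [classSum]

theorem classSum_mul_comm (k : Type*) [CommRing k] (a b : MonoidAlgebra ℤ A) :
    classSum A k (a * b) = classSum A k (b * a) := by
  induction a using MonoidAlgebra.induction_linear with
  | zero => simp
  | add x y hx hy => rw [add_mul, mul_add, map_add, map_add, hx, hy]
  | single g c =>
    induction b using MonoidAlgebra.induction_linear with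
    | zero => simp
    | add x y hx hy => rw [add_mul, mul_add, map_add, map_add, hx, hy]
    | single h d =>
      rw [MonoidAlgebra.single_mul_single, MonoidAlgebra.single_mul_single, classSum_single,
        classSum_single, mul_comm c d]
      congr 1
      exact ConjClasses.mk_eq_mk_iff_isConj.2 (isConj_iff.2 ⟨g⁻¹, by group⟩)

/-- The trace of a matrix over a group ring, as a function on conjugacy classes. -/
noncomputable def classTrace (A k ι : Type*) [Group A] [CommRing k] [Fintype ι] :
    Matrix ι ι (MonoidAlgebra ℤ A) →+ (ConjClasses A →₀ k) :=
  (classSum A k).comp (Matrix.traceAddMonoidHom ι (MonoidAlgebra ℤ A))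

theorem classTrace_apply (k : Type*) {ι : Type*} [CommRing k] [Fintype ι]
    (M : Matrix ι ι (MonoidAlgebra ℤ A)) : classTrace A k ι M = classSum A k M.trace := rfl

theorem classTrace_mul_comm (k : Type*) {ι κ : Type*} [CommRing k] [Fintype ι] [Fintype κ]
    (M : Matrix ι κ (MonoidAlgebra ℤ A)) (N : Matrix κ ι (MonoidAlgebra ℤ A)) :
    classTrace A k ι (M * N) = classTrace A k κ (N * M) := by
  simp only [classTrace_apply, Matrix.trace, Matrix.diag, Matrix.mul_apply, map_sum]
  rw [Finset.sum_comm]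
  exact Finset.sum_congr rfl fun _ _ => Finset.sum_congr rfl fun _ _ => classSum_mul_comm k _ _

theorem classSum_eq_mapRange (k : Type*) [CommRing k] (a : MonoidAlgebra ℤ A) :
    classSum A k a = (classSum A ℤ a).mapRange (Int.castAddHom k) (map_zero _) := by
  induction a using MonoidAlgebra.induction_linear with
  | zero => simp
  | add x y hx hy => rw [map_add, map_add, hx, hy, Finsupp.mapRange_add (map_add _)]
  | single g c => simp

/-- The power map on conjugacy classes. -/
def ConjClasses.powMap (q : ℕ) : ConjClasses A → ConjClasses A :=
  Quotient.map (fun g => g ^ q) fun _ _ h => IsConj.pow q h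

@[simp] theorem ConjClasses.powMap_mk (q : ℕ) (g : A) :
    ConjClasses.powMap q (ConjClasses.mk g) = ConjClasses.mk (g ^ q) := rfl

/-- The trace of the `q`-th power of a matrix is, modulo `q`, the image of its trace under the
`q`-th power map on conjugacy classes. -/
theorem classTrace_pow_prime {ι : Type*} [Fintype ι] [DecidableEq ι] (q : ℕ) [hq : Fact q.Prime]
    (M : Matrix ι ι (MonoidAlgebra ℤ A)) : classTrace A (ZMod q) ι (M ^ q) =
      (classTrace A (ZMod q) ι M).mapDomain (ConjClasses.powMap q) := by
  have hV : ∀ v : ConjClasses A →₀ ZMod q, q • v = 0 := fun v => by ext; simp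
  let Φ : Matrix ι ι (MonoidAlgebra ℤ A) →+ (ConjClasses A →₀ ZMod q) :=
    AddMonoidHom.mk' (fun M => classTrace A (ZMod q) ι (M ^ q))
      (trace_add_pow_prime hV _ (classTrace_mul_comm _))
  let Ψ : Matrix ι ι (MonoidAlgebra ℤ A) →+ (ConjClasses A →₀ ZMod q) :=
    (Finsupp.mapDomain.addMonoidHom (ConjClasses.powMap q)).comp (classTrace A (ZMod q) ι)
  suffices H : Φ = Ψ from DFunLike.congr_fun H M
  refine Matrix.ext_addMonoidHom fun i j => MonoidAlgebra.addMonoidHom_ext fun g c => ?_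
  change classTrace A (ZMod q) ι (Matrix.single i j (MonoidAlgebra.single g c) ^ q) =
    Finsupp.mapDomain _ (classTrace A (ZMod q) ι (Matrix.single i j (MonoidAlgebra.single g c)))
  by_cases hij : i = j
  · subst hij
    have hpow : ∀ (x : MonoidAlgebra ℤ A) (m : ℕ), m ≠ 0 →
        Matrix.single i i x ^ m = Matrix.single i i (x ^ m) := by
      intro x m hm
      induction m with
      | zero => exact absurd rfl hm
      | succ m ih =>
        rcases eq_or_ne m 0 with rfl | h
        · simp
        · rw [pow_succ, ih h, Matrix.single_mul_single_same, pow_succ]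
    rw [hpow _ _ hq.out.ne_zero, classTrace_apply, classTrace_apply, Matrix.trace_single_eq_same,
      Matrix.trace_single_eq_same, MonoidAlgebra.single_pow, classSum_single, classSum_single,
      Finsupp.mapDomain_single, ConjClasses.powMap_mk]
    simp [ZMod.pow_card]
  · obtain ⟨m, hm⟩ := Nat.exists_eq_add_of_le' hq.out.two_le
    have : Matrix.single i j (MonoidAlgebra.single g c) ^ q = 0 := by
      rw [hm, pow_add, pow_two, Matrix.single_mul_single_of_ne _ _ _ _ (Ne.symm hij), mul_zero]
    rw [this, classTrace_apply, classTrace_apply, Matrix.trace_single_eq_of_ne _ _ _ hij]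
    simp

/-- A finitely supported integral function that is invariant modulo `q` under maps `σ q` for
arbitrarily large `q` has support consisting of periodic points. -/
theorem mem_periodicPts_of_mapRange_eq_mapDomain {X : Type*} (S : X →₀ ℤ) {P : ℕ → Prop}
    {σ : ℕ → X → X} (hP : ∀ N, ∃ q, N < q ∧ P q)
    (hS : ∀ q, P q → S.mapRange (Int.castAddHom (ZMod q)) (map_zero _) =
      (S.mapRange (Int.castAddHom (ZMod q)) (map_zero _)).mapDomain (σ q))
    {s : X} (hs : s ∈ S.support) : ∃ q, 1 < q ∧ s ∈ Function.periodicPts (σ q) := by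
  classical
  obtain ⟨q, hNq, hq⟩ := hP (1 + ∑ x ∈ S.support, (S x).natAbs)
  refine ⟨q, by omega, ?_⟩
  have hsupp : (S.mapRange (Int.castAddHom (ZMod q)) (map_zero _)).support = S.support := by
    ext x
    simp only [Finsupp.mem_support_iff, Finsupp.mapRange_apply, Int.coe_castAddHom]
    refine ⟨fun h h0 => h (by simp [h0]), fun h h0 => h ?_⟩
    rw [ZMod.intCast_zmod_eq_zero_iff_dvd] at h0
    refine Int.eq_zero_of_dvd_of_natAbs_lt_natAbs h0 ?_
    have := Finset.single_le_sum (f := fun x => (S x).natAbs) (fun _ _ => Nat.zero_le _)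
      (Finsupp.mem_support_iff.2 h)
    rw [Int.natAbs_natCast]
    omega
  have hsub : S.support ⊆ S.support.image (σ q) := by
    have := Finsupp.mapDomain_support (f := σ q)
      (s := S.mapRange (Int.castAddHom (ZMod q)) (map_zero _))
    rwa [← hS q hq, hsupp] at this
  have himage : S.support.image (σ q) = S.support :=
    (Finset.eq_of_subset_of_card_le hsub Finset.card_image_le).symm
  have hinj : Set.InjOn (σ q) S.support :=
    Finset.card_image_iff.1 (by rw [himage])
  have hmaps : Set.MapsTo (σ q) S.support S.support := fun x hx => by
    have := Finset.mem_image_of_mem (σ q) hx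
    rwa [himage] at this
  obtain ⟨k, hk, hper⟩ := (hmaps.restrict_inj.2 hinj).mem_periodicPts
    (⟨s, hs⟩ : (S.support : Set X))
  refine ⟨k, hk, ?_⟩
  have := congrArg Subtype.val hper
  rwa [hmaps.iterate_restrict] at this

end ConjugacyTrace

section FoxCalculus

variable {ι R : Type*} [Ring R] [DecidableEq ι]

/-- The affine action of the free group whose translation part is the Fox derivative. -/
def foxAction (ρ : FreeGroup ι →* R) : FreeGroup ι →* Equiv.Perm (ι → R) :=
  FreeGroup.lift fun i =>
    { toFun := fun v k => ρ (.of i) * v k + (Pi.single i 1 : ι → R) k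
      invFun := fun v k => ρ (.of i)⁻¹ * (v k - (Pi.single i 1 : ι → R) k)
      left_inv := fun v => by ext k; simp [← mul_assoc, ← map_mul]
      right_inv := fun v => by ext k; simp [← mul_assoc, ← map_mul] }

/-- The Fox derivatives of an element of a free group, with values in a ring `R` to which the
free group maps multiplicatively. -/
def foxDeriv (ρ : FreeGroup ι →* R) (w : FreeGroup ι) : ι → R := foxAction ρ w 0

theorem foxAction_apply (ρ : FreeGroup ι →* R) (w : FreeGroup ι) (v : ι → R) (k : ι) :
    foxAction ρ w v k = ρ w * v k + foxDeriv ρ w k := by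
  induction w using FreeGroup.induction_on generalizing v with
  | C1 => simp [foxDeriv]
  | of i => simp [foxDeriv, foxAction]
  | inv_of i _ =>
    simp only [foxDeriv, foxAction, map_inv, FreeGroup.lift_apply_of, Equiv.Perm.inv_def,
      Equiv.symm, Equiv.coe_fn_mk]
    simp [sub_eq_add_neg, mul_add]
  | mul x y hx hy =>
    rw [foxDeriv, map_mul, Equiv.Perm.mul_apply, Equiv.Perm.mul_apply, hx, hy, hx, hy]
    simp [mul_add, mul_assoc, add_assoc]

theorem foxDeriv_mul (ρ : FreeGroup ι →* R) (u v : FreeGroup ι) (k : ι) :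
    foxDeriv ρ (u * v) k = foxDeriv ρ u k + ρ u * foxDeriv ρ v k := by
  rw [foxDeriv, map_mul, Equiv.Perm.mul_apply, foxAction_apply, add_comm]
  rfl

@[simp] theorem foxDeriv_one (ρ : FreeGroup ι →* R) (k : ι) : foxDeriv ρ 1 k = 0 := by
  simp [foxDeriv]

@[simp] theorem foxDeriv_of (ρ : FreeGroup ι →* R) (i : ι) :
    foxDeriv ρ (.of i) = Pi.single i 1 := by
  ext; simp [foxDeriv, foxAction]

theorem foxDeriv_inv (ρ : FreeGroup ι →* R) (u : FreeGroup ι) (k : ι) :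
    foxDeriv ρ u⁻¹ k = -(ρ u⁻¹ * foxDeriv ρ u k) := by
  have := foxDeriv_mul ρ u⁻¹ u k
  rw [inv_mul_cancel, foxDeriv_one] at this
  exact eq_neg_of_add_eq_zero_left this.symm

theorem foxDeriv_mem (ρ : FreeGroup ι →* R) (S : Subring R) (hS : ∀ w, ρ w ∈ S)
    (w : FreeGroup ι) (k : ι) : foxDeriv ρ w k ∈ S := by
  induction w using FreeGroup.induction_on with
  | C1 => simp
  | of i =>
    rw [foxDeriv_of, Pi.single_apply]
    split_ifs
    exacts [S.one_mem, S.zero_mem]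
  | inv_of i hi => rw [foxDeriv_inv]; exact S.neg_mem (S.mul_mem (hS _) hi)
  | mul x y hx hy => rw [foxDeriv_mul]; exact S.add_mem hx (S.mul_mem (hS _) hy)

/-- A crossed homomorphism is determined by the Fox derivatives and its values on generators. -/
theorem crossedHom_eq_sum_foxDeriv [Fintype ι] (ρ : FreeGroup ι →* R) (d : FreeGroup ι → R)
    (hd : ∀ u v, d (u * v) = d u + ρ u * d v) (w : FreeGroup ι) :
    d w = ∑ j, foxDeriv ρ w j * d (.of j) := by
  have h1 : d 1 = 0 := by simpa using hd 1 1
  induction w using FreeGroup.induction_on with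
  | C1 => simp [h1]
  | of i => simp [Pi.single_apply]
  | inv_of i hi =>
    have := hd (.of i)⁻¹ (.of i)
    rw [inv_mul_cancel, h1] at this
    rw [eq_neg_of_add_eq_zero_left this.symm, hi]
    simp only [foxDeriv_inv, Finset.mul_sum, mul_assoc, neg_mul, Finset.sum_neg_distrib]
  | mul x y hx hy =>
    rw [hd, hx, hy]
    simp only [foxDeriv_mul, add_mul, Finset.sum_add_distrib, Finset.mul_sum, mul_assoc]

/-- The fundamental formula of the Fox calculus. -/
theorem sum_foxDeriv_mul_sub_one [Fintype ι] (ρ : FreeGroup ι →* R) (w : FreeGroup ι) :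
    ∑ j, foxDeriv ρ w j * (ρ (.of j) - 1) = ρ w - 1 :=
  (crossedHom_eq_sum_foxDeriv ρ (fun w => ρ w - 1) (fun u v => by
    rw [map_mul, mul_sub, mul_one]; abel) w).symm

end FoxCalculus

section FoxJacobian

variable {ι : Type*}

/-- Free group elements viewed as inner automorphisms, in the group ring of the automorphism
group. -/
noncomputable def innRep (ι : Type*) :
    FreeGroup ι →* MonoidAlgebra ℤ (MulAut (FreeGroup ι)) :=
  (MonoidAlgebra.of ℤ (MulAut (FreeGroup ι))).comp MulAut.conj

theorem innRep_apply (w : FreeGroup ι) :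
    innRep ι w = MonoidAlgebra.single (MulAut.conj w) 1 := rfl

theorem mul_conj_mul_inv {F : Type*} [Group F] (a : MulAut F) (w : F) :
    a * MulAut.conj w * a⁻¹ = MulAut.conj (a w) := by
  ext x
  simp [MulAut.conj_apply, MulAut.mul_apply]

theorem single_inv_mul_innRep (a : MulAut (FreeGroup ι)) (w : FreeGroup ι) :
    MonoidAlgebra.single a⁻¹ 1 * innRep ι (a w) = innRep ι w * MonoidAlgebra.single a⁻¹ 1 := by
  rw [innRep_apply, innRep_apply, MonoidAlgebra.single_mul_single,
    MonoidAlgebra.single_mul_single, ← mul_conj_mul_inv]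
  simp [mul_assoc]

variable [DecidableEq ι]

/-- The Jacobian of an automorphism of a free group, twisted by the inverse of the automorphism
so as to be antimultiplicative. -/
noncomputable def foxJacobian (a : MulAut (FreeGroup ι)) :
    Matrix ι ι (MonoidAlgebra ℤ (MulAut (FreeGroup ι))) :=
  Matrix.of fun j k => MonoidAlgebra.single a⁻¹ 1 * foxDeriv (innRep ι) (a (.of j)) k

theorem foxJacobian_apply (a : MulAut (FreeGroup ι)) (j k : ι) :
    foxJacobian a j k = MonoidAlgebra.single a⁻¹ 1 * foxDeriv (innRep ι) (a (.of j)) k := rfl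

theorem foxJacobian_one : foxJacobian (1 : MulAut (FreeGroup ι)) = 1 := by
  ext1 j k
  rw [foxJacobian_apply, inv_one, ← MonoidAlgebra.one_def, one_mul, MulAut.one_apply, foxDeriv_of,
    Matrix.one_apply, Pi.single_apply]
  simp [eq_comm]

theorem foxJacobian_conj (w : FreeGroup ι) (j k : ι) : foxJacobian (MulAut.conj w) j k =
    (1 : Matrix ι ι _) j k +
      (1 - innRep ι (.of j)) * (innRep ι w⁻¹ * foxDeriv (innRep ι) w k) := by
  rw [foxJacobian_apply, MulAut.conj_apply, foxDeriv_mul, foxDeriv_mul, foxDeriv_inv, foxDeriv_of,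
    ← map_inv, ← innRep_apply, Matrix.one_apply, Pi.single_apply]
  simp only [mul_add, mul_neg, ← mul_assoc, ← map_mul, inv_mul_cancel, sub_mul, one_mul]
  rw [map_one, one_mul, map_mul, eq_comm]
  simp only [eq_comm (a := k)]
  simp only [mul_assoc]
  abel

/-- The augmentation of a group ring. -/
noncomputable def augment (A : Type*) [Group A] : MonoidAlgebra ℤ A →+* ℤ :=
  (MonoidAlgebra.lift ℤ ℤ A 1).toRingHom

@[simp] theorem augment_single {A : Type*} [Group A] (g : A) (c : ℤ) :
    augment A (MonoidAlgebra.single g c) = c := by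
  simp [augment]

theorem augment_eq_zero_of_classSum_eq_zero {A : Type*} [Group A] {x : MonoidAlgebra ℤ A}
    (h : classSum A ℤ x = 0) : augment A x = 0 := by
  have : (augment A).toAddMonoidHom =
      (Finsupp.liftAddHom fun _ => AddMonoidHom.id ℤ).comp (classSum A ℤ) :=
    MonoidAlgebra.addMonoidHom_ext fun g c => by simp
  have := DFunLike.congr_fun this x
  simpa [h] using this

theorem augment_foxDeriv_mul (u v : FreeGroup ι) (k : ι) :
    augment _ (foxDeriv (innRep ι) (u * v) k) =
      augment _ (foxDeriv (innRep ι) u k) + augment _ (foxDeriv (innRep ι) v k) := by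
  rw [foxDeriv_mul, map_add, map_mul, innRep_apply, augment_single, one_mul]

variable [Fintype ι]

theorem single_inv_mul_foxDeriv (a : MulAut (FreeGroup ι)) (w : FreeGroup ι) (k : ι) :
    MonoidAlgebra.single a⁻¹ 1 * foxDeriv (innRep ι) (a w) k =
      ∑ l, foxDeriv (innRep ι) w l * foxJacobian a l k := by
  refine crossedHom_eq_sum_foxDeriv (innRep ι)
    (fun w => MonoidAlgebra.single a⁻¹ 1 * foxDeriv (innRep ι) (a w) k) (fun u v => ?_) w
  rw [map_mul, foxDeriv_mul, mul_add, ← mul_assoc, single_inv_mul_innRep, mul_assoc]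

theorem foxJacobian_mul (b a : MulAut (FreeGroup ι)) :
    foxJacobian (b * a) = foxJacobian a * foxJacobian b := by
  ext1 j k
  rw [foxJacobian_apply, Matrix.mul_apply, mul_inv_rev, MulAut.mul_apply]
  simp only [foxJacobian_apply a, mul_assoc]
  rw [← Finset.mul_sum, ← single_inv_mul_foxDeriv, ← mul_assoc, MonoidAlgebra.single_mul_single,
    one_mul]

theorem foxJacobian_pow (a : MulAut (FreeGroup ι)) (m : ℕ) :
    foxJacobian (a ^ m) = foxJacobian a ^ m := by
  induction m with
  | zero => rw [pow_zero, pow_zero, foxJacobian_one]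
  | succ m ih => rw [pow_succ, foxJacobian_mul, ih, pow_succ']

/-- The Lefschetz element of an automorphism of a free group. -/
noncomputable def foxLefschetz (a : MulAut (FreeGroup ι)) :
    MonoidAlgebra ℤ (MulAut (FreeGroup ι)) :=
  MonoidAlgebra.single a⁻¹ 1 - (foxJacobian a).trace

/-- Up to conjugacy, the Lefschetz element only depends on the outer automorphism. -/
theorem classSum_foxLefschetz_mul_conj (k : Type*) [CommRing k] (a : MulAut (FreeGroup ι))
    (w : FreeGroup ι) : classSum _ k (foxLefschetz (a * MulAut.conj w)) =
      classSum _ k (foxLefschetz a) := by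
  have h : (foxJacobian (a * MulAut.conj w)).trace = (foxJacobian a).trace +
      ∑ j, (1 - innRep ι (.of j)) *
        (innRep ι w⁻¹ * (MonoidAlgebra.single a⁻¹ 1 * foxDeriv (innRep ι) (a w) j)) := by
    rw [foxJacobian_mul, Matrix.trace, Matrix.trace, ← Finset.sum_add_distrib]
    refine Finset.sum_congr rfl fun j _ => ?_
    rw [Matrix.diag, Matrix.mul_apply, single_inv_mul_foxDeriv]
    simp only [foxJacobian_conj, add_mul, Finset.sum_add_distrib, Finset.mul_sum, mul_assoc]
    congr 1
    rw [← Matrix.mul_apply, one_mul]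
    rfl
  have h2 : classSum _ k (∑ j, (1 - innRep ι (.of j)) *
      (innRep ι w⁻¹ * (MonoidAlgebra.single a⁻¹ 1 * foxDeriv (innRep ι) (a w) j))) =
      classSum _ k (MonoidAlgebra.single (a * MulAut.conj w)⁻¹ 1 -
        MonoidAlgebra.single a⁻¹ 1) := by
    have h3 : innRep ι w⁻¹ * (MonoidAlgebra.single a⁻¹ 1 *
        ∑ j, foxDeriv (innRep ι) (a w) j * (innRep ι (.of j) - 1)) =
        MonoidAlgebra.single a⁻¹ 1 - MonoidAlgebra.single (a * MulAut.conj w)⁻¹ 1 := by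
      rw [sum_foxDeriv_mul_sub_one, mul_sub, single_inv_mul_innRep, mul_sub, ← mul_assoc,
        ← map_mul, inv_mul_cancel, map_one, one_mul, mul_one, mul_inv_rev, innRep_apply, map_inv,
        MonoidAlgebra.single_mul_single, one_mul]
    rw [← neg_sub, ← h3, map_sum, Finset.mul_sum, Finset.mul_sum, map_neg, map_sum,
      ← Finset.sum_neg_distrib]
    refine Finset.sum_congr rfl fun j _ => ?_
    rw [classSum_mul_comm, ← neg_sub, mul_neg, map_neg]
    simp only [mul_assoc]
  rw [foxLefschetz, foxLefschetz, map_sub, h, map_add, h2, map_sub, map_sub]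
  abel

theorem classSum_foxLefschetz_pow_prime (q : ℕ) [Fact q.Prime] (a : MulAut (FreeGroup ι)) :
    classSum _ (ZMod q) (foxLefschetz (a ^ q)) =
      (classSum _ (ZMod q) (foxLefschetz a)).mapDomain (ConjClasses.powMap q) := by
  have := classTrace_pow_prime q (foxJacobian a)
  rw [← foxJacobian_pow, classTrace_apply, classTrace_apply] at this
  rw [foxLefschetz, foxLefschetz, map_sub, map_sub, this, classSum_single, classSum_single,
    Finsupp.mapDomain_sub, Finsupp.mapDomain_single, ConjClasses.powMap_mk, inv_pow]

theorem augment_foxLefschetz {a : MulAut (FreeGroup ι)}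
    (ha : ∀ e : FreeGroup ι → ℤ, (∀ x y, e (x * y) = e x + e y) → ∀ x, e (a x) = e x) :
    augment _ (foxLefschetz a) = 1 - Fintype.card ι := by
  rw [foxLefschetz, map_sub, augment_single, Matrix.trace, map_sum]
  congr 1
  rw [Finset.sum_congr rfl (g := fun _ => 1)]
  · simp
  · intro j _
    rw [Matrix.diag, foxJacobian_apply, map_mul, augment_single, one_mul,
      ha (fun w => augment _ (foxDeriv (innRep ι) w j)) (fun x y => augment_foxDeriv_mul x y j)]
    simp

theorem exists_of_mem_support_classSum_foxLefschetz {a : MulAut (FreeGroup ι)}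
    {s : ConjClasses (MulAut (FreeGroup ι))}
    (hs : s ∈ (classSum _ ℤ (foxLefschetz a)).support) :
    ∃ w, s = ConjClasses.mk (a⁻¹ * MulAut.conj w) := by
  have key : ∀ x ∈ (MonoidAlgebra.mapDomainRingHom ℤ
      (MulAut.conj : FreeGroup ι →* MulAut (FreeGroup ι))).range,
      (∀ w, s ≠ ConjClasses.mk (a⁻¹ * MulAut.conj w)) →
      classSum _ ℤ (MonoidAlgebra.single a⁻¹ 1 * x) s = 0 := by
    rintro _ ⟨x, rfl⟩ h
    induction x using MonoidAlgebra.induction_linear with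
    | zero => simp
    | add x y hx hy => rw [map_add, mul_add, map_add, Finsupp.add_apply, hx, hy, add_zero]
    | single g c =>
      simp [MonoidAlgebra.single_mul_single, (h g).symm]
  by_contra! h
  rw [Finsupp.mem_support_iff] at hs
  apply hs
  have hmem : ∀ w, innRep ι w ∈ (MonoidAlgebra.mapDomainRingHom ℤ
      (MulAut.conj : FreeGroup ι →* MulAut (FreeGroup ι))).range := fun w =>
    ⟨.single w 1, by simp [innRep_apply]⟩
  have h1 := key 1 (one_mem _) h
  rw [mul_one] at h1
  rw [foxLefschetz, map_sub, Matrix.trace, map_sum, Finsupp.sub_apply, Finsupp.finsetSum_apply,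
    Finset.sum_eq_zero fun j _ => ?_, sub_zero, h1]
  exact key _ (foxDeriv_mem _ _ hmem _ _) h

end FoxJacobian

section Minkowski

theorem exists_one_add_pow_eq {R : Type*} [Ring R] (D : R) (p : ℕ) :
    ∃ X, (1 + D) ^ p = 1 + p * D + D * D * X := by
  induction p with
  | zero => exact ⟨0, by simp⟩
  | succ p ih =>
    obtain ⟨X, hX⟩ := ih
    refine ⟨p + X * (1 + D), ?_⟩
    rw [pow_succ, hX]
    simp only [Nat.cast_succ, mul_add, add_mul, mul_one, one_mul, mul_assoc,
      ← (Nat.cast_commute p D).eq]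
    rw [← mul_assoc D (p : R) D, ← (Nat.cast_commute p D).eq, mul_assoc]
    abel

variable {ι : Type*}

theorem Matrix.eq_zero_of_forall_three_pow_smul {D : Matrix ι ι ℤ}
    (h : ∀ k : ℕ, ∃ E : Matrix ι ι ℤ, D = (3 : ℤ) ^ (k + 1) • E) : D = 0 := by
  ext i j
  by_contra h0
  obtain ⟨E, hE⟩ := h (D i j).natAbs
  refine h0 (Int.eq_zero_of_dvd_of_natAbs_lt_natAbs (d := 3 ^ ((D i j).natAbs + 1))
    ⟨E i j, by simpa using congrFun (congrFun hE i) j⟩ ?_)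
  rw [Int.natAbs_pow]
  exact (Nat.lt_succ_self _).trans (Nat.lt_pow_self (by norm_num))

variable [Fintype ι] [DecidableEq ι]

/-- An integral matrix of prime order that is congruent to the identity modulo `3` is trivial. -/
theorem Matrix.eq_one_of_pow_prime_eq_one {T : Matrix ι ι ℤ} {p : ℕ} (hp : p.Prime)
    (hT : T ^ p = 1) (h3 : ∃ E : Matrix ι ι ℤ, T - 1 = (3 : ℤ) • E) : T = 1 := by
  have hcancel : ∀ (c : ℤ) (X Y : Matrix ι ι ℤ), c ≠ 0 → c • X = c • Y → X = Y :=
    fun c X Y hc h => smul_right_injective _ hc h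
  refine sub_eq_zero.1 (Matrix.eq_zero_of_forall_three_pow_smul fun k => ?_)
  induction k with
  | zero => simpa using h3
  | succ k ih =>
    obtain ⟨E, hE⟩ := ih
    have hT1 : T = 1 + (T - 1) := by abel
    rw [pow_succ _ (k + 1)]
    suffices h : ∃ E', E = (3 : ℤ) • E' by
      obtain ⟨E', rfl⟩ := h
      exact ⟨E', by rw [hE, smul_smul]⟩
    rw [hT1, hE] at hT
    by_cases hp3 : p = 3
    · subst hp3
      refine ⟨-((3 : ℤ) ^ k • (E * E)) - (3 : ℤ) ^ (2 * k) • (E * E * E), ?_⟩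
      refine hcancel (3 ^ (k + 2)) _ _ (by positivity) ?_
      have h0 : (1 + (3 : ℤ) ^ (k + 1) • E) ^ 3 - 1 = (3 : ℤ) ^ (k + 2) • E +
          ((3 : ℤ) ^ (2 * k + 3) • (E * E) + (3 : ℤ) ^ (3 * k + 3) • (E * E * E)) := by
        have : ∀ D : Matrix ι ι ℤ, (1 + D) ^ 3 - 1 = (3 : ℤ) • D + (3 : ℤ) • (D * D) + D * D * D :=
          fun D => by noncomm_ring
        rw [this]
        simp only [smul_mul_assoc, mul_smul_comm, smul_smul]
        rw [add_assoc]
        congr 2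
        · ring
        · congr 2
          ring
        · congr 1
          ring
      rw [hT, sub_self, eq_comm] at h0
      rw [eq_neg_of_add_eq_zero_left h0, smul_smul, smul_sub, smul_neg, smul_smul, smul_smul,
        neg_add']
      congr 3 <;> ring
    · obtain ⟨X, hX⟩ := exists_one_add_pow_eq ((3 : ℤ) ^ (k + 1) • E) p
      rw [hT, add_assoc, left_eq_add] at hX
      have h1 : (p : ℤ) • E = (3 : ℤ) • -((3 : ℤ) ^ k • (E * E * X)) := by
        refine hcancel (3 ^ (k + 1)) _ _ (by positivity) ?_
        rw [smul_comm, smul_smul (3 ^ (k + 1)), ← pow_succ, smul_neg, smul_smul (3 ^ (k + 1 + 1)),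
          ← pow_add]
        simp only [smul_mul_assoc, mul_smul_comm, smul_smul] at hX
        rw [eq_neg_iff_add_eq_zero, ← hX, zsmul_eq_mul _ (p : ℤ)]
        push_cast
        rw [mul_smul_comm]
        congr 2
        ring
      have hcop : IsCoprime (p : ℤ) 3 := by
        exact_mod_cast Nat.isCoprime_iff_coprime.2 ((Nat.coprime_primes hp Nat.prime_three).2 hp3)
      obtain ⟨u, v, huv⟩ := hcop
      refine ⟨u • -((3 : ℤ) ^ k • (E * E * X)) + v • E, ?_⟩
      rw [smul_add, smul_comm 3 u, ← h1, smul_smul, smul_smul, ← add_smul, mul_comm 3 v, huv,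
        one_smul]

/-- An integral matrix of finite order that is congruent to the identity modulo `3` is trivial. -/
theorem Matrix.eq_one_of_pow_eq_one {T : Matrix ι ι ℤ} {m : ℕ} (hm : m ≠ 0) (hT : T ^ m = 1)
    (h3 : (Int.castRingHom (ZMod 3)).mapMatrix T = 1) : T = 1 := by
  by_contra h
  have hfin : orderOf T ≠ 0 := (isOfFinOrder_iff_pow_eq_one.2 ⟨m, by omega, hT⟩).orderOf_pos.ne'
  obtain ⟨p, hp, hdvd⟩ := Nat.exists_prime_and_dvd (mt orderOf_eq_one_iff.1 h)
  have hord := orderOf_pow_orderOf_div hfin hdvd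
  have hone : T ^ (orderOf T / p) = 1 := by
    refine Matrix.eq_one_of_pow_prime_eq_one hp
      (by rw [← pow_mul, Nat.div_mul_cancel hdvd, pow_orderOf_eq_one]) ?_
    have hmod : (Int.castRingHom (ZMod 3)).mapMatrix (T ^ (orderOf T / p) - 1) = 0 := by
      rw [map_sub, map_pow, h3, one_pow, map_one, sub_self]
    have hdiv : ∀ i j, ∃ e, (T ^ (orderOf T / p) - 1) i j = 3 * e := fun i j => by
      have := congrFun (congrFun hmod i) j
      rw [RingHom.mapMatrix_apply, Matrix.map_apply] at this
      exact (ZMod.intCast_zmod_eq_zero_iff_dvd _ 3).1 this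
    choose E hE using hdiv
    exact ⟨Matrix.of E, by ext i j; simpa using hE i j⟩
  rw [hone, orderOf_one] at hord
  exact hp.ne_one hord.symm

end Minkowski

section HomologyAction

variable {ι : Type*} [DecidableEq ι]

/-- The matrix of the action of an automorphism of a free group on the abelianization. -/
def abelianMatrix (a : MulAut (FreeGroup ι)) : Matrix ι ι ℤ :=
  Matrix.of fun j k => foxDeriv (1 : FreeGroup ι →* ℤ) (a (.of j)) k

theorem foxDeriv_one_mul (u v : FreeGroup ι) (k : ι) : foxDeriv (1 : FreeGroup ι →* ℤ) (u * v) k =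
    foxDeriv (1 : FreeGroup ι →* ℤ) u k + foxDeriv (1 : FreeGroup ι →* ℤ) v k := by
  simp [foxDeriv_mul]

theorem abelianMatrix_conj (w : FreeGroup ι) : abelianMatrix (MulAut.conj w) = 1 := by
  ext j k
  simp [abelianMatrix, foxDeriv_mul, foxDeriv_inv, Matrix.one_apply, Pi.single_apply, eq_comm]

theorem abelianMatrix_one : abelianMatrix (1 : MulAut (FreeGroup ι)) = 1 := by
  rw [← map_one MulAut.conj, abelianMatrix_conj]

variable [Fintype ι]

theorem eq_sum_foxDeriv_of_additive {e : FreeGroup ι → ℤ} (he : ∀ x y, e (x * y) = e x + e y)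
    (w : FreeGroup ι) : e w = ∑ j, foxDeriv (1 : FreeGroup ι →* ℤ) w j * e (.of j) :=
  crossedHom_eq_sum_foxDeriv 1 e (by simpa using he) w

theorem abelianMatrix_mul (a b : MulAut (FreeGroup ι)) :
    abelianMatrix (a * b) = abelianMatrix b * abelianMatrix a := by
  ext j k
  exact eq_sum_foxDeriv_of_additive (e := fun w => foxDeriv (1 : FreeGroup ι →* ℤ) (a w) k)
    (fun x y => by rw [map_mul, foxDeriv_one_mul]) (b (.of j))

theorem abelianMatrix_pow (a : MulAut (FreeGroup ι)) (m : ℕ) :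
    abelianMatrix (a ^ m) = abelianMatrix a ^ m := by
  induction m with
  | zero => rw [pow_zero, pow_zero, abelianMatrix_one]
  | succ m ih => rw [pow_succ, abelianMatrix_mul, ih, pow_succ']

theorem apply_eq_of_abelianMatrix_eq_one {a : MulAut (FreeGroup ι)} (ha : abelianMatrix a = 1)
    {e : FreeGroup ι → ℤ} (he : ∀ x y, e (x * y) = e x + e y) (x : FreeGroup ι) :
    e (a x) = e x := by
  rw [eq_sum_foxDeriv_of_additive (e := fun x => e (a x)) (fun x y => by rw [map_mul, he]) x,
    eq_sum_foxDeriv_of_additive he x]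
  refine Finset.sum_congr rfl fun j _ => ?_
  congr 1
  rw [eq_sum_foxDeriv_of_additive he]
  change ∑ k, abelianMatrix a j k * _ = _
  simp [ha, Matrix.one_apply]

end HomologyAction

section Torelli

variable {ι : Type*} [DecidableEq ι]

theorem eq_one_of_pow_eq_one_of_additive {a : MulAut (FreeGroup ι)} {m : ℕ} (hm : m ≠ 0)
    (ham : a ^ m = 1)
    (ha : ∀ e : FreeGroup ι → ℤ, (∀ x y, e (x * y) = e x + e y) → ∀ x, e (a x) = e x) :
    a = 1 :=
  MulEquiv.ext fun x => eq_of_forall_isPolyMap fun _ _ hf =>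
    hf.apply_eq_of_pow_eq_one hm ham ha x

theorem FreeGroup.conj_injective [Nontrivial ι] :
    Function.Injective (MulAut.conj : FreeGroup ι →* MulAut (FreeGroup ι)) := by
  refine (injective_iff_map_eq_one _).2 fun x hx => FreeGroup.eq_one_of_forall_commute fun y => ?_
  have := DFunLike.congr_fun hx y
  rw [MulAut.conj_apply, MulAut.one_apply, mul_inv_eq_iff_eq_mul] at this
  exact this.symm

/-- An automorphism conjugate to one of its proper powers, some power of which is inner, has finite
order. -/
theorem pow_eq_one_of_isConj_pow [Nontrivial ι] {g : MulAut (FreeGroup ι)} {Q m : ℕ} (hQ : 2 ≤ Q)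
    (hg : IsConj g (g ^ Q)) (hgm : g ^ m ∈ innerAutSubgroup (FreeGroup ι)) : g ^ m = 1 := by
  obtain ⟨b, hb⟩ := isConj_iff.1 hg
  obtain ⟨f, hf⟩ := hgm
  have hbf : b f = f ^ Q := by
    apply FreeGroup.conj_injective
    rw [← mul_conj_mul_inv, hf, map_pow, hf, ← conj_pow, hb, ← pow_mul, ← pow_mul, mul_comm]
  have hb' : f = (b⁻¹ f) ^ Q := by
    rw [← map_pow, ← hbf, MulAut.inv_apply_self]
  have hγ : ∀ i, (b⁻¹ ^ i) f = ((b⁻¹ ^ (i + 1)) f) ^ Q := fun i => by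
    rw [pow_succ, MulAut.mul_apply, ← map_pow, ← hb']
  have hf1 : f = 1 := eq_of_forall_isPolyMap fun k e he => by
    simpa using he.apply_mul_mul_eq hQ hγ 0 1 1
  rw [← hf, hf1, map_one]

theorem ConjClasses.powMap_iterate_mk {A : Type*} [Group A] (q k : ℕ) (g : A) :
    (ConjClasses.powMap q)^[k] (ConjClasses.mk g) = ConjClasses.mk (g ^ q ^ k) := by
  induction k with
  | zero => simp
  | succ k ih => rw [Function.iterate_succ_apply', ih, powMap_mk, ← pow_mul, pow_succ]

variable [Fintype ι]

/-- An automorphism of a free group which has finite order as an outer automorphism and acts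
trivially on the abelianization is inner. -/
theorem mem_innerAutSubgroup_of_pow_mem [Nontrivial ι] {a : MulAut (FreeGroup ι)} {m : ℕ}
    (hm : m ≠ 0) (ham : a ^ m ∈ innerAutSubgroup (FreeGroup ι))
    (ha : ∀ e : FreeGroup ι → ℤ, (∀ x y, e (x * y) = e x + e y) → ∀ x, e (a x) = e x) :
    a ∈ innerAutSubgroup (FreeGroup ι) := by
  have hne : classSum _ ℤ (foxLefschetz a) ≠ 0 := fun h => by
    have h1 := augment_eq_zero_of_classSum_eq_zero h
    rw [augment_foxLefschetz ha] at h1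
    have h2 := Fintype.one_lt_card (α := ι)
    omega
  obtain ⟨s, hs⟩ := Finsupp.support_nonempty_iff.2 hne
  obtain ⟨w, rfl⟩ := exists_of_mem_support_classSum_foxLefschetz hs
  obtain ⟨q, hq, k, hk, hper⟩ := mem_periodicPts_of_mapRange_eq_mapDomain
    (classSum _ ℤ (foxLefschetz a)) (P := fun q => q.Prime ∧ q ≡ 1 [MOD m])
    (σ := ConjClasses.powMap) (fun N => by
      obtain ⟨q, h1, h2, h3⟩ := Nat.exists_prime_gt_modEq_one N hm
      exact ⟨q, h2, h1, h3⟩)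
    (fun q ⟨hq, hqm⟩ => by
      have := Fact.mk hq
      rw [← classSum_eq_mapRange, ← classSum_foxLefschetz_pow_prime]
      obtain ⟨l, hl⟩ := (Nat.modEq_iff_dvd' hq.one_le).1 hqm.symm
      obtain ⟨f, hf⟩ := ham
      have : a ^ q = a * MulAut.conj (f ^ l) := by
        rw [map_pow, hf, ← pow_mul, ← hl, ← pow_succ', Nat.sub_add_cancel hq.one_le]
      rw [this, classSum_foxLefschetz_mul_conj]) hs
  set g := a⁻¹ * MulAut.conj w with hg
  have hgm : g ^ m ∈ innerAutSubgroup (FreeGroup ι) := by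
    rw [← QuotientGroup.eq_one_iff] at ham ⊢
    have hw : (MulAut.conj w : MulAut (FreeGroup ι) ⧸ innerAutSubgroup (FreeGroup ι)) = 1 :=
      (QuotientGroup.eq_one_iff _).2 ⟨w, rfl⟩
    rw [QuotientGroup.mk_pow] at ham
    rw [hg, QuotientGroup.mk_pow, QuotientGroup.mk_mul, hw, mul_one, QuotientGroup.mk_inv, inv_pow,
      ham, inv_one]
  have hper' := hper.eq
  rw [ConjClasses.powMap_iterate_mk, ConjClasses.mk_eq_mk_iff_isConj] at hper'
  have hg1 := pow_eq_one_of_isConj_pow (Nat.one_lt_pow (Nat.pos_iff_ne_zero.1 hk) hq) hper'.symm hgm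
  have hone : g = 1 := eq_one_of_pow_eq_one_of_additive hm hg1 fun e he x => by
    have h1 := ha e he (a⁻¹ (MulAut.conj w x))
    rw [MulAut.apply_inv_self] at h1
    rw [hg, MulAut.mul_apply, ← h1, MulAut.conj_apply, he, he]
    have h2 := he w w⁻¹
    have h3 := he 1 1
    rw [mul_inv_cancel] at h2
    rw [mul_one] at h3
    linarith
  exact ⟨w, (inv_mul_eq_one.1 hone).symm⟩

theorem mem_innerAutSubgroup_of_abelianMatrix_eq_one [Nonempty ι] {a : MulAut (FreeGroup ι)}
    {m : ℕ} (hm : m ≠ 0) (ham : a ^ m ∈ innerAutSubgroup (FreeGroup ι))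
    (ha : (Int.castRingHom (ZMod 3)).mapMatrix (abelianMatrix a) = 1) :
    a ∈ innerAutSubgroup (FreeGroup ι) := by
  have h1 : abelianMatrix a = 1 := by
    refine Matrix.eq_one_of_pow_eq_one hm ?_ ha
    obtain ⟨w, hw⟩ := ham
    rw [← abelianMatrix_pow, ← hw, abelianMatrix_conj]
  rcases subsingleton_or_nontrivial ι with hι | hι
  · obtain ⟨i⟩ := ‹Nonempty ι›
    let _ : Inhabited ι := ⟨i⟩
    let _ : Unique ι := Unique.mk' ι
    refine eq_one_of_pow_eq_one_of_additive hm ?_ (fun _ => apply_eq_of_abelianMatrix_eq_one h1) ▸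
      one_mem _
    obtain ⟨w, hw⟩ := ham
    rw [← hw]
    refine MulEquiv.ext fun x => ?_
    rw [MulAut.conj_apply, MulAut.one_apply, mul_inv_eq_iff_eq_mul]
    exact IsCyclic.commGroup.mul_comm w x
  · exact mem_innerAutSubgroup_of_pow_mem hm ham fun _ => apply_eq_of_abelianMatrix_eq_one h1

end Torelli

/-- For every `n ≥ 1` there is a uniform bound on the cardinalities of the finite
subgroups of the outer automorphism group of the free group on `n` generators. -/
theorem out_free_bounded_finite_subgroups (n : ℕ) (hn : 1 ≤ n) :
    ∃ C : ℕ, ∀ H : Subgroup (Out (FreeGroup (Fin n))), Finite H → Nat.card H ≤ C := by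
  have : Nonempty (Fin n) := ⟨⟨0, hn⟩⟩
  refine ⟨Nat.card (Matrix (Fin n) (Fin n) (ZMod 3)), fun H hH => ?_⟩
  let π : MulAut (FreeGroup (Fin n)) →* Out (FreeGroup (Fin n)) :=
    QuotientGroup.mk' (innerAutSubgroup (FreeGroup (Fin n)))
  have hsurj : ∀ h : H, ∃ a, π a = h := fun h => QuotientGroup.mk'_surjective _ h.1
  choose r hr using hsurj
  refine Nat.card_le_card_of_injective
    (fun h => (Int.castRingHom (ZMod 3)).mapMatrix (abelianMatrix (r h))) fun h₁ h₂ h => ?_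
  obtain ⟨m, hm, hpow⟩ := isOfFinOrder_iff_pow_eq_one.1 (isOfFinOrder_of_finite (h₁⁻¹ * h₂))
  have hker : ∀ a, π a = 1 ↔ a ∈ innerAutSubgroup (FreeGroup (Fin n)) := fun a =>
    QuotientGroup.eq_one_iff a
  have hπ : π ((r h₁)⁻¹ * r h₂) = (h₁⁻¹ * h₂ : H) := by
    rw [map_mul, map_inv, H.coe_mul, H.coe_inv, ← hr h₁, ← hr h₂]
  have hmem := mem_innerAutSubgroup_of_abelianMatrix_eq_one (a := (r h₁)⁻¹ * r h₂) hm.ne'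
    ((hker _).1 (by rw [map_pow, hπ, ← H.coe_pow, hpow, H.coe_one])) (by
      dsimp only at h
      rw [abelianMatrix_mul, map_mul, ← h, ← map_mul, ← abelianMatrix_mul, inv_mul_cancel,
        abelianMatrix_one, map_one])
  rw [← hker, hπ] at hmem
  exact inv_mul_eq_one.1 (Subtype.ext hmem)
end

section
/- For every n ≥ 2, the group GL_n(ℤ) is not virtually abelian: it has no abelian subgroup of finite index. -/
/-- A group is virtually abelian if it has an abelian subgroup of finite index. -/
def VirtuallyAbelian (G : Type*) [Group G] : Prop :=
  ∃ H : Subgroup G, H.FiniteIndex ∧ ∀ a b : H, a * b = b * a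

theorem transvection_one_pow {ι R : Type*} [Fintype ι] [DecidableEq ι] [CommRing R]
    {i j : ι} (h : i ≠ j) (k : ℕ) :
    Matrix.transvection i j (1 : R) ^ k = Matrix.transvection i j (k : R) := by
  induction k with
  | zero => simp
  | succ k ih =>
    rw [pow_succ, ih, Nat.cast_succ, Matrix.transvection_mul_transvection_same _ _ h]

/-- Opposite transvections commute only if the product of their parameters vanishes. -/
theorem mul_eq_zero_of_commute_transvection {ι R : Type*} [Fintype ι] [DecidableEq ι] [CommRing R]
    {i j : ι} (h : i ≠ j) {a b : R}
    (hab : Commute (Matrix.transvection i j a) (Matrix.transvection j i b)) : a * b = 0 := by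
  have := congrFun (congrFun hab.eq i) i
  simpa [Matrix.transvection, add_mul, mul_add, h, h.symm] using this

theorem VirtuallyAbelian.exists_commute_pow {G : Type*} [Group G] (hG : VirtuallyAbelian G)
    (x y : G) : ∃ k l : ℕ, 0 < k ∧ 0 < l ∧ Commute (x ^ k) (y ^ l) := by
  obtain ⟨H, hH, hcomm⟩ := hG
  obtain ⟨k, hk, -, hxk⟩ := Subgroup.exists_pow_mem_of_index_ne_zero hH.index_ne_zero x
  obtain ⟨l, hl, -, hyl⟩ := Subgroup.exists_pow_mem_of_index_ne_zero hH.index_ne_zero y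
  exact ⟨k, l, hk, hl, congrArg Subtype.val (hcomm ⟨_, hxk⟩ ⟨_, hyl⟩)⟩

/-- For every `n ≥ 2`, the group `GL n ℤ` is not virtually abelian. -/
theorem glnz_not_virtually_abelian (n : ℕ) (hn : 2 ≤ n) :
    ¬ VirtuallyAbelian (GL (Fin n) ℤ) := by
  intro hG
  have h : (⟨0, by omega⟩ : Fin n) ≠ ⟨1, by omega⟩ := by simp
  obtain ⟨k, l, hk, hl, hkl⟩ :=
    hG.exists_commute_pow (Matrix.SpecialLinearGroup.transvection h (1 : ℤ) : GL (Fin n) ℤ)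
      (Matrix.SpecialLinearGroup.transvection h.symm (1 : ℤ))
  have hmat := hkl.map (Units.coeHom (Matrix (Fin n) (Fin n) ℤ))
  rw [map_pow, map_pow] at hmat
  change Commute (Matrix.transvection _ _ (1 : ℤ) ^ k) (Matrix.transvection _ _ (1 : ℤ) ^ l) at hmat
  rw [transvection_one_pow h, transvection_one_pow h.symm] at hmat
  have hzero := mul_eq_zero_of_commute_transvection h hmat
  have hpos : (0 : ℤ) < k * l := by positivity
  exact hpos.ne' hzero
end

section
/- For every n ≥ 2, the outer automorphism group Out(F_n) of the free group F_n on n generators is not virtually abelian: it has no abelian subgroup of finite index. -/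
namespace FreeGroup

variable {α : Type*} [DecidableEq α]

/-- The endomorphism of a free group sending the generator `i` to `i * w` and fixing the
other generators. -/
def transvectionHom (i : α) (w : FreeGroup α) : FreeGroup α →* FreeGroup α :=
  lift fun l => if l = i then of i * w else of l

theorem transvectionHom_of_self (i : α) (w : FreeGroup α) :
    transvectionHom i w (of i) = of i * w := by
  simp [transvectionHom]

theorem transvectionHom_of_ne {i l : α} (h : l ≠ i) (w : FreeGroup α) :
    transvectionHom i w (of l) = of l := by
  simp [transvectionHom, h]

theorem transvectionHom_comp {i : α} {v w : FreeGroup α} (hw : transvectionHom i v w = w)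
    (hvw : v * w = 1) : (transvectionHom i v).comp (transvectionHom i w) = MonoidHom.id _ := by
  ext l
  rcases eq_or_ne l i with rfl | hl
  · simp [transvectionHom_of_self, hw, mul_assoc, hvw]
  · simp [transvectionHom_of_ne hl]

/-- The automorphism of a free group sending the generator `i` to `i * j` and fixing the
other generators. -/
def transvection {i j : α} (h : j ≠ i) : MulAut (FreeGroup α) :=
  MonoidHom.toMulEquiv (transvectionHom i (of j)) (transvectionHom i (of j)⁻¹)
    (transvectionHom_comp (transvectionHom_of_ne h _) (inv_mul_cancel _))
    (transvectionHom_comp (by rw [_root_.map_inv, transvectionHom_of_ne h]) (mul_inv_cancel _))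

theorem transvection_of_self {i j : α} (h : j ≠ i) : transvection h (of i) = of i * of j :=
  transvectionHom_of_self i _

theorem transvection_of_ne {i j l : α} (h : j ≠ i) (hl : l ≠ i) :
    transvection h (of l) = of l :=
  transvectionHom_of_ne hl _

theorem transvection_pow_of_ne {i j l : α} (h : j ≠ i) (hl : l ≠ i) (k : ℕ) :
    (transvection h ^ k) (of l) = of l := by
  induction k with
  | zero => simp
  | succ k ih => rw [pow_succ, MulAut.mul_apply, transvection_of_ne h hl, ih]

theorem transvection_pow_of_self {i j : α} (h : j ≠ i) (k : ℕ) :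
    (transvection h ^ k) (of i) = of i * of j ^ k := by
  induction k with
  | zero => simp
  | succ k ih =>
    rw [pow_succ, MulAut.mul_apply, transvection_of_self, _root_.map_mul, ih,
      transvection_pow_of_ne h h, mul_assoc, pow_succ]

/-- Positive powers of opposite transvections do not commute modulo inner automorphisms. -/
theorem transvection_pow_mul_ne {i j : α} (hji : j ≠ i) (hij : i ≠ j) {k m : ℕ}
    (hk : k ≠ 0) (hm : m ≠ 0) :
    (QuotientGroup.mk (transvection hji ^ k * transvection hij ^ m) :
        MulAut (FreeGroup α) ⧸ innerAutSubgroup (FreeGroup α)) ≠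
      QuotientGroup.mk (transvection hij ^ m * transvection hji ^ k) := by
  intro h
  obtain ⟨g, hg⟩ := QuotientGroup.eq.1 h
  have hg' : transvection hji ^ k * transvection hij ^ m * MulAut.conj g =
      transvection hij ^ m * transvection hji ^ k := by
    rw [hg, mul_inv_cancel_left]
  let φ : FreeGroup α →* Multiplicative ℤ :=
    lift fun l => if l = i then Multiplicative.ofAdd 1 else 1
  have key := congrArg (fun σ : MulAut (FreeGroup α) => φ (σ (of i))) hg'
  have hi : φ (of i) = Multiplicative.ofAdd 1 := by simp [φ]
  have hj : φ (of j) = 1 := by simp [φ, hji]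
  simp only [MulAut.mul_apply, MulAut.conj_apply, _root_.map_mul, _root_.map_inv, mul_inv_cancel_comm,
    transvection_pow_of_ne hij hij, transvection_pow_of_self, map_pow, hi, hj, one_pow,
    mul_one, one_mul] at key
  have := congrArg Multiplicative.toAdd key
  simp [hk, hm] at this

end FreeGroup

/-- For every `n ≥ 2`, the outer automorphism group of the free group on `n` generators
is not virtually abelian. -/
theorem out_free_not_virtually_abelian (n : ℕ) (hn : 2 ≤ n) :
    ¬ VirtuallyAbelian (Out (FreeGroup (Fin n))) := by
  rintro ⟨H, hH, hab⟩
  have hij : (⟨0, by omega⟩ : Fin n) ≠ ⟨1, by omega⟩ := by simp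
  let π : MulAut (FreeGroup (Fin n)) →* Out (FreeGroup (Fin n)) :=
    QuotientGroup.mk' (innerAutSubgroup (FreeGroup (Fin n)))
  obtain ⟨k, hk, -, hak⟩ := Subgroup.exists_pow_mem_of_index_ne_zero hH.index_ne_zero
    (π (FreeGroup.transvection hij.symm))
  obtain ⟨m, hm, -, hbm⟩ := Subgroup.exists_pow_mem_of_index_ne_zero hH.index_ne_zero
    (π (FreeGroup.transvection hij))
  have hcomm := congrArg Subtype.val (hab ⟨_, hak⟩ ⟨_, hbm⟩)
  simp only [Subgroup.coe_mul, ← map_pow, ← map_mul] at hcomm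
  exact FreeGroup.transvection_pow_mul_ne hij.symm hij hk.ne' hm.ne' hcomm
end
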